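/- arXiv:1907.12497 — 3 statements merged into one kernel-verified Lean document; each statement's English description precedes it below -/
import Mathlib

section
/- Let A be an m-homogeneous supersolvable line arrangement in ℙ² with m ≥ 3, having at least two modular points, and let k with 0 ≤ k ≤ m−2 and w ∈ W(m−2,k) be such that A and A(w) have isomorphic intersection lattices. Then the number M of modular points of A is: M = 2 if k < m−2; M = 3 if k = m−2 ≥ 2; and M = 4 if k = m−2 = 1. Moreover, when k = m−2, A is projectively equivalent to the full monomial arrangement A(m−2,1,3). -/
open scoped LinearAlgebra.Projectivization

noncomputable section

attribute [local instance] Classical.propDecidable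

/-- A point of the complex projective plane. -/
abbrev ProjPoint := ℙ ℂ (Fin 3 → ℂ)

/-- A line of the complex projective plane, encoded by a defining linear form
up to scalar, i.e. as a point of the dual projective plane. -/
abbrev ProjLine := ℙ ℂ (Module.Dual ℂ (Fin 3 → ℂ))

/-- The incidence relation between points and lines of `ℙ²`. -/
def PointOnLine (p : ProjPoint) (L : ProjLine) : Prop :=
  L.rep p.rep = 0

/-- The multiplicity of a point with respect to a line arrangement:
the number of lines of the arrangement passing through the point. -/
def mult (A : Finset ProjLine) (p : ProjPoint) : ℕ :=
  Set.ncard {L : ProjLine | L ∈ A ∧ PointOnLine p L}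

/-- An intersection point of a line arrangement: a point lying on at least two lines. -/
def IsIntersectionPoint (A : Finset ProjLine) (p : ProjPoint) : Prop :=
  2 ≤ mult A p

/-- A modular point: an intersection point `p` such that for any other intersection
point `q`, the line through `p` and `q` belongs to the arrangement. -/
def IsModular (A : Finset ProjLine) (p : ProjPoint) : Prop :=
  IsIntersectionPoint A p ∧
    ∀ q : ProjPoint, IsIntersectionPoint A q → q ≠ p →
      ∃ L ∈ A, PointOnLine p L ∧ PointOnLine q L

/-- A supersolvable line arrangement: one possessing a modular point. -/
def IsSupersolvable (A : Finset ProjLine) : Prop :=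
  ∃ p, IsModular A p

/-- An `m`-homogeneous supersolvable line arrangement: supersolvable, and all
modular points have multiplicity `m`. -/
def IsHomogSS (A : Finset ProjLine) (m : ℕ) : Prop :=
  IsSupersolvable A ∧ ∀ p, IsModular A p → mult A p = m

/-- `nk A k` is the number of intersection points of multiplicity `k` of `A`. -/
def nk (A : Finset ProjLine) (k : ℕ) : ℕ :=
  Set.ncard {p : ProjPoint | IsIntersectionPoint A p ∧ mult A p = k}

/-- A pencil: all lines pass through a common point. -/
def IsPencil (A : Finset ProjLine) : Prop :=
  ∃ p, ∀ L ∈ A, PointOnLine p L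

/-- The linear form `a x + b y + c z` on `ℂ³`. -/
def mkForm (a b c : ℂ) : Module.Dual ℂ (Fin 3 → ℂ) :=
  a • LinearMap.proj 0 + b • LinearMap.proj 1 + c • LinearMap.proj 2

lemma mkForm_apply (a b c : ℂ) (v : Fin 3 → ℂ) :
    mkForm a b c v = a * v 0 + b * v 1 + c * v 2 := by
  simp [mkForm, smul_eq_mul]

lemma mkForm_ne_zero {a b c : ℂ} (h : a ≠ 0 ∨ b ≠ 0 ∨ c ≠ 0) :
    mkForm a b c ≠ 0 := by
  intro h0
  have h1 := congrArg (fun φ => φ (Pi.single 0 1)) h0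
  have h2 := congrArg (fun φ => φ (Pi.single 1 1)) h0
  have h3 := congrArg (fun φ => φ (Pi.single 2 1)) h0
  simp only [mkForm_apply] at h1 h2 h3
  simp [Pi.single_apply] at h1 h2 h3
  rcases h with h | h | h <;> simp_all

/-- The projective line with equation `a x + b y + c z = 0`. -/
def mkLine (a b c : ℂ) (h : a ≠ 0 ∨ b ≠ 0 ∨ c ≠ 0) : ProjLine :=
  Projectivization.mk ℂ (mkForm a b c) (mkForm_ne_zero h)

lemma vec_ne_zero {a b c : ℂ} (h : a ≠ 0 ∨ b ≠ 0 ∨ c ≠ 0) :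
    (![a, b, c] : Fin 3 → ℂ) ≠ 0 := by
  intro h0
  have h1 := congrFun h0 0
  have h2 := congrFun h0 1
  have h3 := congrFun h0 2
  rcases h with h | h | h <;> simp_all

/-- The projective point with homogeneous coordinates `(a : b : c)`. -/
def mkPoint (a b c : ℂ) (h : a ≠ 0 ∨ b ≠ 0 ∨ c ≠ 0) : ProjPoint :=
  Projectivization.mk ℂ ![a, b, c] (vec_ne_zero h)

/-- The full monomial line arrangement `A(m-2,1,3)`, defined by the equation
`xyz(x^{m-2}-y^{m-2})(y^{m-2}-z^{m-2})(x^{m-2}-z^{m-2}) = 0`: it consists of the three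
coordinate lines together with the lines `x = ζ y`, `y = ζ z`, `x = ζ z` for `ζ`
ranging over the `(m-2)`-nd roots of unity. -/
def monomialArr (m : ℕ) : Finset ProjLine :=
  {mkLine 1 0 0 (Or.inl one_ne_zero), mkLine 0 1 0 (Or.inr (Or.inl one_ne_zero)),
    mkLine 0 0 1 (Or.inr (Or.inr one_ne_zero))} ∪
  ((Polynomial.nthRoots (m - 2) (1 : ℂ)).toFinset.image fun ζ =>
    mkLine 1 (-ζ) 0 (Or.inl one_ne_zero)) ∪
  ((Polynomial.nthRoots (m - 2) (1 : ℂ)).toFinset.image fun ζ =>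
    mkLine 0 1 (-ζ) (Or.inr (Or.inl one_ne_zero))) ∪
  ((Polynomial.nthRoots (m - 2) (1 : ℂ)).toFinset.image fun ζ =>
    mkLine 1 0 (-ζ) (Or.inl one_ne_zero))

/-- The line arrangement `A(w)`, defined by the equation
`xyz(x^n-y^n)(x^n-z^n)·∏_{j<k}(z - w_j y) = 0`. -/
def arrW (n k : ℕ) (w : ℕ → ℂ) : Finset ProjLine :=
  {mkLine 1 0 0 (Or.inl one_ne_zero), mkLine 0 1 0 (Or.inr (Or.inl one_ne_zero)),
    mkLine 0 0 1 (Or.inr (Or.inr one_ne_zero))} ∪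
  ((Polynomial.nthRoots n (1 : ℂ)).toFinset.image fun ζ =>
    mkLine 1 (-ζ) 0 (Or.inl one_ne_zero)) ∪
  ((Polynomial.nthRoots n (1 : ℂ)).toFinset.image fun ζ =>
    mkLine 1 0 (-ζ) (Or.inl one_ne_zero)) ∪
  ((Finset.range k).image fun j =>
    mkLine 0 (-(w j)) 1 (Or.inr (Or.inr one_ne_zero)))

/-- `w` encodes an element of `W(n,k)`: a `k`-tuple (given by the values `w j` for
`j < k`) of pairwise distinct `n`-th roots of unity. -/
def IsWTuple (n k : ℕ) (w : ℕ → ℂ) : Prop :=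
  (∀ j < k, (w j) ^ n = 1) ∧ ∀ i < k, ∀ j < k, i ≠ j → w i ≠ w j

/-- Two tuples in `W(n,k)` lie in the same orbit of the group
`G = (Σ_k × μ_n) ⋊ μ_2`: they agree up to a permutation of the entries, a simultaneous
multiplication by an `n`-th root of unity, and a possible simultaneous inversion. -/
def SameGOrbit (n k : ℕ) (w w' : ℕ → ℂ) : Prop :=
  ∃ σ : Equiv.Perm (Fin k), ∃ a : ℂ, a ^ n = 1 ∧
    ((∀ j : Fin k, w' j = a * w (σ j)) ∨ (∀ j : Fin k, w' j = a * (w (σ j))⁻¹))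

/-- `A` and `B` have isomorphic intersection lattices (the same combinatorics):
there is a bijection `φ : A → B` such that any subfamily of lines of `A` has a
common point if and only if its image under `φ` does. -/
def SameCombinatorics (A B : Finset ProjLine) : Prop :=
  ∃ φ : ProjLine → ProjLine, Set.BijOn φ (↑A : Set ProjLine) (↑B : Set ProjLine) ∧
    ∀ S : Finset ProjLine, S ⊆ A →
      ((∃ p : ProjPoint, ∀ L ∈ S, PointOnLine p L) ↔
        (∃ p : ProjPoint, ∀ L ∈ S, PointOnLine p (φ L)))

/-- The projective transformation of lines induced by a linear automorphism of `ℂ³`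
(acting on defining linear forms through the inverse dual map). -/
def lineMap (T : (Fin 3 → ℂ) ≃ₗ[ℂ] (Fin 3 → ℂ)) : ProjLine → ProjLine :=
  Projectivization.map
    (T.symm.dualMap : Module.Dual ℂ (Fin 3 → ℂ) →ₗ[ℂ] Module.Dual ℂ (Fin 3 → ℂ))
    T.symm.dualMap.injective

/-- Two line arrangements are projectively equivalent if some projective linear
transformation of `ℙ²` maps the set of lines of one onto the set of lines of the other. -/
def ProjEquiv (A B : Finset ProjLine) : Prop :=
  ∃ T : (Fin 3 → ℂ) ≃ₗ[ℂ] (Fin 3 → ℂ),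
    (lineMap T) '' (↑A : Set ProjLine) = (↑B : Set ProjLine)

/-! ### Coordinates -/

lemma pointOnLine_mk (v : Fin 3 → ℂ) (hv : v ≠ 0) (f : Module.Dual ℂ (Fin 3 → ℂ)) (hf : f ≠ 0) :
    PointOnLine (Projectivization.mk ℂ v hv) (Projectivization.mk ℂ f hf) ↔ f v = 0 := by
  unfold PointOnLine
  obtain ⟨a, ha⟩ := Projectivization.exists_smul_eq_mk_rep ℂ v hv
  obtain ⟨b, hb⟩ := Projectivization.exists_smul_eq_mk_rep ℂ f hf
  rw [← ha, ← hb]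
  simp [Units.smul_def]

lemma pointOnLine_coord {x y z a b c : ℂ} (h : x ≠ 0 ∨ y ≠ 0 ∨ z ≠ 0)
    (h' : a ≠ 0 ∨ b ≠ 0 ∨ c ≠ 0) :
    PointOnLine (mkPoint x y z h) (mkLine a b c h') ↔ a * x + b * y + c * z = 0 := by
  unfold mkPoint mkLine
  rw [pointOnLine_mk, mkForm_apply]
  simp

lemma exists_mkPoint (p : ProjPoint) : ∃ x y z h, p = mkPoint x y z h := by
  induction p using Projectivization.ind with
  | h v hv =>
    have hv' : v 0 ≠ 0 ∨ v 1 ≠ 0 ∨ v 2 ≠ 0 := by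
      by_contra! hc
      apply hv
      ext i
      fin_cases i <;> simp [hc]
    refine ⟨v 0, v 1, v 2, hv', ?_⟩
    unfold mkPoint
    congr 1
    ext i
    fin_cases i <;> rfl

lemma form_eq_mkForm (f : Module.Dual ℂ (Fin 3 → ℂ)) :
    f = mkForm (f (Pi.single 0 1)) (f (Pi.single 1 1)) (f (Pi.single 2 1)) := by
  apply LinearMap.pi_ext'
  intro i
  ext
  fin_cases i <;> simp [mkForm_apply, Pi.single_apply]

lemma exists_mkLine (L : ProjLine) : ∃ a b c h, L = mkLine a b c h := by
  induction L using Projectivization.ind with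
  | h f hf =>
    have hf' : f (Pi.single 0 1) ≠ 0 ∨ f (Pi.single 1 1) ≠ 0 ∨ f (Pi.single 2 1) ≠ 0 := by
      by_contra! hc
      apply hf
      rw [form_eq_mkForm f, hc.1, hc.2.1, hc.2.2]
      simp [mkForm]
    refine ⟨_, _, _, hf', ?_⟩
    unfold mkLine
    congr 1
    exact form_eq_mkForm f

lemma prop_iff {a b c a' b' c' : ℂ} (h : a ≠ 0 ∨ b ≠ 0 ∨ c ≠ 0) (h' : a' ≠ 0 ∨ b' ≠ 0 ∨ c' ≠ 0) :
    (∃ t : ℂ, t * a' = a ∧ t * b' = b ∧ t * c' = c) ↔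
      a * b' = b * a' ∧ a * c' = c * a' ∧ b * c' = c * b' := by
  constructor
  · rintro ⟨t, rfl, rfl, rfl⟩
    refine ⟨by ring, by ring, by ring⟩
  · rintro ⟨h1, h2, h3⟩
    rcases h' with h' | h' | h'
    · refine ⟨a / a', ?_, ?_, ?_⟩ <;> field_simp <;> grind
    · refine ⟨b / b', ?_, ?_, ?_⟩ <;> field_simp <;> grind
    · refine ⟨c / c', ?_, ?_, ?_⟩ <;> field_simp <;> grind

lemma mkPoint_eq_iff {a b c a' b' c' : ℂ} (h : a ≠ 0 ∨ b ≠ 0 ∨ c ≠ 0)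
    (h' : a' ≠ 0 ∨ b' ≠ 0 ∨ c' ≠ 0) :
    mkPoint a b c h = mkPoint a' b' c' h' ↔
      a * b' = b * a' ∧ a * c' = c * a' ∧ b * c' = c * b' := by
  rw [← prop_iff h h']
  unfold mkPoint
  rw [Projectivization.mk_eq_mk_iff']
  simp

lemma mkForm_inj {a b c a' b' c' : ℂ} : mkForm a b c = mkForm a' b' c' ↔
    a = a' ∧ b = b' ∧ c = c' := by
  constructor
  · intro h0
    have h1 := congrArg (fun φ => φ (Pi.single 0 1)) h0
    have h2 := congrArg (fun φ => φ (Pi.single 1 1)) h0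
    have h3 := congrArg (fun φ => φ (Pi.single 2 1)) h0
    simp only [mkForm_apply] at h1 h2 h3
    simp [Pi.single_apply] at h1 h2 h3
    exact ⟨h1, h2, h3⟩
  · rintro ⟨rfl, rfl, rfl⟩
    rfl

lemma smul_mkForm (t a b c : ℂ) : t • mkForm a b c = mkForm (t * a) (t * b) (t * c) := by
  simp [mkForm, smul_smul]

lemma mkLine_eq_iff {a b c a' b' c' : ℂ} (h : a ≠ 0 ∨ b ≠ 0 ∨ c ≠ 0)
    (h' : a' ≠ 0 ∨ b' ≠ 0 ∨ c' ≠ 0) :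
    mkLine a b c h = mkLine a' b' c' h' ↔
      a * b' = b * a' ∧ a * c' = c * a' ∧ b * c' = c * b' := by
  rw [← prop_iff h h']
  unfold mkLine
  rw [Projectivization.mk_eq_mk_iff']
  simp only [smul_mkForm, mkForm_inj]

lemma eq_or_eq' {p q : ProjPoint} {L L' : ProjLine} (h1 : PointOnLine p L) (h2 : PointOnLine q L)
    (h3 : PointOnLine p L') (h4 : PointOnLine q L') : p = q ∨ L = L' := by
  obtain ⟨x, y, z, h, rfl⟩ := exists_mkPoint p
  obtain ⟨x', y', z', h', rfl⟩ := exists_mkPoint q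
  obtain ⟨a, b, c, g, rfl⟩ := exists_mkLine L
  obtain ⟨a', b', c', g', rfl⟩ := exists_mkLine L'
  rw [pointOnLine_coord] at h1 h2 h3 h4
  rw [mkPoint_eq_iff, mkLine_eq_iff]
  have key := Configuration.ofField.crossProduct_eq_zero_of_dotProduct_eq_zero
    (a := ![x, y, z]) (b := ![x', y', z']) (c := ![a, b, c]) (d := ![a', b', c'])
    (by simp [Matrix.vec3_dotProduct]; linear_combination h1)
    (by simp [Matrix.vec3_dotProduct]; linear_combination h2)
    (by simp [Matrix.vec3_dotProduct]; linear_combination h3)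
    (by simp [Matrix.vec3_dotProduct]; linear_combination h4)
  rcases key with key | key
  · left
    have e0 := congrFun key 0
    have e1 := congrFun key 1
    have e2 := congrFun key 2
    simp [crossProduct] at e0 e1 e2
    refine ⟨by linear_combination e2, by linear_combination -e1, by linear_combination e0⟩
  · right
    have e0 := congrFun key 0
    have e1 := congrFun key 1
    have e2 := congrFun key 2
    simp [crossProduct] at e0 e1 e2
    refine ⟨by linear_combination e2, by linear_combination -e1, by linear_combination e0⟩

/-! ### Intersection points and transport -/

lemma finite_through (A : Finset ProjLine) (p : ProjPoint) :
    {L : ProjLine | L ∈ A ∧ PointOnLine p L}.Finite :=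
  A.finite_toSet.subset fun _ hL => hL.1

lemma isInt_iff {A : Finset ProjLine} {p : ProjPoint} : IsIntersectionPoint A p ↔
    ∃ L ∈ A, ∃ L' ∈ A, L ≠ L' ∧ PointOnLine p L ∧ PointOnLine p L' := by
  unfold IsIntersectionPoint mult
  rw [show (2 : ℕ) = 1 + 1 from rfl, Nat.add_one_le_iff, Set.one_lt_ncard (finite_through A p)]
  constructor
  · rintro ⟨L, hL, L', hL', hne⟩
    exact ⟨L, hL.1, L', hL'.1, hne, hL.2, hL'.2⟩
  · rintro ⟨L, hL, L', hL', hne, h1, h2⟩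
    exact ⟨L, ⟨hL, h1⟩, L', ⟨hL', h2⟩, hne⟩

/-- A combinatorial isomorphism, recorded on lines and on intersection points. -/
structure CIso (A B : Finset ProjLine) (φ : ProjLine → ProjLine) (Φ : ProjPoint → ProjPoint) :
    Prop where
  lines : Set.BijOn φ (↑A : Set ProjLine) (↑B : Set ProjLine)
  points : Set.BijOn Φ {p | IsIntersectionPoint A p} {p | IsIntersectionPoint B p}
  inc : ∀ p, IsIntersectionPoint A p → ∀ L ∈ A, (PointOnLine p L ↔ PointOnLine (Φ p) (φ L))

lemma CIso.mult_eq {A B : Finset ProjLine} {φ Φ} (e : CIso A B φ Φ) {p : ProjPoint}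
    (hp : IsIntersectionPoint A p) : mult B (Φ p) = mult A p := by
  unfold mult
  have : {L : ProjLine | L ∈ B ∧ PointOnLine (Φ p) L} =
      φ '' {L : ProjLine | L ∈ A ∧ PointOnLine p L} := by
    ext M
    constructor
    · rintro ⟨hM, hpM⟩
      obtain ⟨L, hL, rfl⟩ := e.lines.surjOn hM
      exact ⟨L, ⟨hL, (e.inc p hp L hL).2 hpM⟩, rfl⟩
    · rintro ⟨L, ⟨hL, hpL⟩, rfl⟩
      exact ⟨e.lines.mapsTo hL, (e.inc p hp L hL).1 hpL⟩
  rw [this, Set.ncard_image_of_injOn]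
  exact e.lines.injOn.mono fun L hL => hL.1

lemma CIso.modular_iff {A B : Finset ProjLine} {φ Φ} (e : CIso A B φ Φ) {p : ProjPoint}
    (hp : IsIntersectionPoint A p) : IsModular B (Φ p) ↔ IsModular A p := by
  constructor
  · rintro ⟨_, h⟩
    refine ⟨hp, fun q hq hne => ?_⟩
    obtain ⟨M, hM, h1, h2⟩ := h (Φ q) (e.points.mapsTo hq)
      (fun hc => hne (e.points.injOn hq hp hc))
    obtain ⟨L, hL, rfl⟩ := e.lines.surjOn hM
    exact ⟨L, hL, (e.inc p hp L hL).2 h1, (e.inc q hq L hL).2 h2⟩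
  · rintro ⟨_, h⟩
    refine ⟨e.points.mapsTo hp, fun q hq hne => ?_⟩
    obtain ⟨q, hq', rfl⟩ := e.points.surjOn hq
    obtain ⟨L, hL, h1, h2⟩ := h q hq' (fun hc => hne (by rw [hc]))
    exact ⟨φ L, e.lines.mapsTo hL, (e.inc p hp L hL).1 h1, (e.inc q hq' L hL).1 h2⟩

lemma CIso.modular_image {A B : Finset ProjLine} {φ Φ} (e : CIso A B φ Φ) :
    {p | IsModular B p} = Φ '' {p | IsModular A p} := by
  ext q
  constructor
  · intro hq
    obtain ⟨p, hp, rfl⟩ := e.points.surjOn hq.1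
    exact ⟨p, (e.modular_iff hp).1 hq, rfl⟩
  · rintro ⟨p, hp, rfl⟩
    exact (e.modular_iff hp.1).2 hp

lemma CIso.ncard_eq {A B : Finset ProjLine} {φ Φ} (e : CIso A B φ Φ) :
    {p | IsModular B p}.ncard = {p | IsModular A p}.ncard := by
  rw [e.modular_image, Set.ncard_image_of_injOn]
  exact e.points.injOn.mono fun p hp => hp.1

lemma exists_cIso {A B : Finset ProjLine} (h : SameCombinatorics A B) :
    ∃ φ Φ, CIso A B φ Φ := by
  obtain ⟨φ, hφ, hS⟩ := h
  have key : ∀ p, IsIntersectionPoint A p →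
      ∃ q, ∀ L ∈ A, (PointOnLine p L ↔ PointOnLine q (φ L)) := by
    intro p hp
    obtain ⟨L1, h1, L2, h2, hne, hp1, hp2⟩ := isInt_iff.1 hp
    obtain ⟨q, hq⟩ := (hS (A.filter fun L => PointOnLine p L) (Finset.filter_subset _ _)).1
      ⟨p, fun L hL => (Finset.mem_filter.1 hL).2⟩
    refine ⟨q, fun L hL => ⟨fun hpL => hq L (Finset.mem_filter.2 ⟨hL, hpL⟩), fun hqL => ?_⟩⟩
    obtain ⟨p', hp'⟩ := (hS {L, L1, L2} (by
      intro M hM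
      simp only [Finset.mem_insert, Finset.mem_singleton] at hM
      rcases hM with rfl | rfl | rfl <;> assumption)).2 ⟨q, by
      intro M hM
      simp only [Finset.mem_insert, Finset.mem_singleton] at hM
      rcases hM with rfl | rfl | rfl
      · exact hqL
      · exact hq _ (Finset.mem_filter.2 ⟨h1, hp1⟩)
      · exact hq _ (Finset.mem_filter.2 ⟨h2, hp2⟩)⟩
    rcases eq_or_eq' hp1 (hp' L1 (by simp)) hp2 (hp' L2 (by simp)) with h | h
    · rw [h]
      exact hp' L (by simp)
    · exact absurd h hne
  choose! Φ hΦ using key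
  refine ⟨φ, Φ, hφ, ⟨?_, ?_, ?_⟩, hΦ⟩
  · intro p hp
    obtain ⟨L1, h1, L2, h2, hne, hp1, hp2⟩ := isInt_iff.1 hp
    exact isInt_iff.2 ⟨φ L1, hφ.mapsTo h1, φ L2, hφ.mapsTo h2,
      fun hc => hne (hφ.injOn h1 h2 hc), (hΦ p hp L1 h1).1 hp1, (hΦ p hp L2 h2).1 hp2⟩
  · intro p hp p' hp' heq
    obtain ⟨L1, h1, L2, h2, hne, hp1, hp2⟩ := isInt_iff.1 hp
    have a1 := (hΦ p' hp' L1 h1).2 (heq ▸ (hΦ p hp L1 h1).1 hp1)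
    have a2 := (hΦ p' hp' L2 h2).2 (heq ▸ (hΦ p hp L2 h2).1 hp2)
    exact (eq_or_eq' hp1 a1 hp2 a2).resolve_right hne
  · intro q hq
    obtain ⟨M1, g1, M2, g2, hne, hq1, hq2⟩ := isInt_iff.1 hq
    obtain ⟨L1, h1, rfl⟩ := hφ.surjOn g1
    obtain ⟨L2, h2, rfl⟩ := hφ.surjOn g2
    obtain ⟨p, hp⟩ := (hS {L1, L2} (by
      intro M hM
      simp only [Finset.mem_insert, Finset.mem_singleton] at hM
      rcases hM with rfl | rfl <;> assumption)).2 ⟨q, by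
      intro M hM
      simp only [Finset.mem_insert, Finset.mem_singleton] at hM
      rcases hM with rfl | rfl <;> assumption⟩
    have hp1 := hp L1 (by simp)
    have hp2 := hp L2 (by simp)
    have hpi : IsIntersectionPoint A p :=
      isInt_iff.2 ⟨L1, h1, L2, h2, fun hc => hne (by rw [hc]), hp1, hp2⟩
    refine ⟨p, hpi, ?_⟩
    exact (eq_or_eq' ((hΦ p hpi L1 h1).1 hp1) hq1 ((hΦ p hpi L2 h2).1 hp2) hq2).resolve_right hne

/-! ### Analysis of `arrW` -/

def ptP : ProjPoint := mkPoint 0 0 1 (Or.inr (Or.inr one_ne_zero))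
def ptQ : ProjPoint := mkPoint 0 1 0 (Or.inr (Or.inl one_ne_zero))
def ptR : ProjPoint := mkPoint 1 0 0 (Or.inl one_ne_zero)
def ptD : ProjPoint := mkPoint 1 1 1 (Or.inl one_ne_zero)

lemma mem_arrW {n k : ℕ} (hn : 0 < n) {w : ℕ → ℂ} {L : ProjLine} : L ∈ arrW n k w ↔
    L = mkLine 1 0 0 (Or.inl one_ne_zero) ∨ L = mkLine 0 1 0 (Or.inr (Or.inl one_ne_zero)) ∨
    L = mkLine 0 0 1 (Or.inr (Or.inr one_ne_zero)) ∨
    (∃ ζ : ℂ, ζ ^ n = 1 ∧ L = mkLine 1 (-ζ) 0 (Or.inl one_ne_zero)) ∨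
    (∃ ζ : ℂ, ζ ^ n = 1 ∧ L = mkLine 1 0 (-ζ) (Or.inl one_ne_zero)) ∨
    (∃ j < k, L = mkLine 0 (-(w j)) 1 (Or.inr (Or.inr one_ne_zero))) := by
  unfold arrW
  simp only [Finset.mem_union, Finset.mem_insert, Finset.mem_singleton, Finset.mem_image,
    Multiset.mem_toFinset, Polynomial.mem_nthRoots hn, Finset.mem_range]
  simp only [eq_comm (a := L), or_assoc]

lemma mem_monomialArr {m : ℕ} (hm : 3 ≤ m) {L : ProjLine} : L ∈ monomialArr m ↔
    L = mkLine 1 0 0 (Or.inl one_ne_zero) ∨ L = mkLine 0 1 0 (Or.inr (Or.inl one_ne_zero)) ∨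
    L = mkLine 0 0 1 (Or.inr (Or.inr one_ne_zero)) ∨
    (∃ ζ : ℂ, ζ ^ (m - 2) = 1 ∧ L = mkLine 1 (-ζ) 0 (Or.inl one_ne_zero)) ∨
    (∃ ζ : ℂ, ζ ^ (m - 2) = 1 ∧ L = mkLine 0 1 (-ζ) (Or.inr (Or.inl one_ne_zero))) ∨
    (∃ ζ : ℂ, ζ ^ (m - 2) = 1 ∧ L = mkLine 1 0 (-ζ) (Or.inl one_ne_zero)) := by
  have hn : 0 < m - 2 := by omega
  unfold monomialArr
  simp only [Finset.mem_union, Finset.mem_insert, Finset.mem_singleton, Finset.mem_image,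
    Multiset.mem_toFinset, Polynomial.mem_nthRoots hn]
  simp only [eq_comm (a := L), or_assoc]

lemma root_ne_zero {n : ℕ} (hn : 0 < n) {ζ : ℂ} (h : ζ ^ n = 1) : ζ ≠ 0 := by
  rintro rfl
  rw [zero_pow hn.ne'] at h
  exact zero_ne_one h

lemma arrW_subset_monomial {m k : ℕ} (hm : 3 ≤ m) {w : ℕ → ℂ} (hw : IsWTuple (m - 2) k w) :
    arrW (m - 2) k w ⊆ monomialArr m := by
  have hn : 0 < m - 2 := by omega
  intro L hL
  rw [mem_arrW hn] at hL
  rw [mem_monomialArr hm]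
  rcases hL with h | h | h | h | h | ⟨j, hj, h⟩
  · exact Or.inl h
  · exact Or.inr (Or.inl h)
  · exact Or.inr (Or.inr (Or.inl h))
  · exact Or.inr (Or.inr (Or.inr (Or.inl h)))
  · exact Or.inr (Or.inr (Or.inr (Or.inr (Or.inr h))))
  · have h1 := hw.1 j hj
    have h0 := root_ne_zero hn h1
    refine Or.inr (Or.inr (Or.inr (Or.inr (Or.inl ⟨(w j)⁻¹, by rw [inv_pow, h1, inv_one], ?_⟩))))
    rw [h, mkLine_eq_iff]
    refine ⟨by simp, by simp, by field_simp⟩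

lemma w_surj {n : ℕ} (hn : 0 < n) {w : ℕ → ℂ} (hw : IsWTuple n n w) {ζ : ℂ} (hζ : ζ ^ n = 1) :
    ∃ j < n, w j = ζ := by
  have h1 : (Finset.range n).image w ⊆ (Polynomial.nthRoots n (1 : ℂ)).toFinset := by
    intro x hx
    obtain ⟨j, hj, rfl⟩ := Finset.mem_image.1 hx
    rw [Multiset.mem_toFinset, Polynomial.mem_nthRoots hn]
    exact hw.1 j (Finset.mem_range.1 hj)
  have h2 : ((Finset.range n).image w).card = n := by
    rw [Finset.card_image_of_injOn, Finset.card_range]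
    intro i hi j hj hij
    by_contra hne
    exact hw.2 i (by simpa using hi) j (by simpa using hj) hne hij
  have h3 : (Polynomial.nthRoots n (1 : ℂ)).toFinset.card ≤ ((Finset.range n).image w).card := by
    rw [h2]
    exact (Multiset.toFinset_card_le _).trans (Polynomial.card_nthRoots n 1)
  have h4 := Finset.eq_of_subset_of_card_le h1 h3
  have : ζ ∈ (Finset.range n).image w := by
    rw [h4, Multiset.mem_toFinset, Polynomial.mem_nthRoots hn]
    exact hζ
  obtain ⟨j, hj, rfl⟩ := Finset.mem_image.1 this
  exact ⟨j, Finset.mem_range.1 hj, rfl⟩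

/-- The possible lines of `arrW` through a given point. -/
lemma arrW_through {n k : ℕ} (hn : 0 < n) {w : ℕ → ℂ} (hw : IsWTuple n k w) {x y z : ℂ}
    (h : x ≠ 0 ∨ y ≠ 0 ∨ z ≠ 0) {L : ProjLine} (hL : L ∈ arrW n k w)
    (hp : PointOnLine (mkPoint x y z h) L) :
    (L = mkLine 1 0 0 (Or.inl one_ne_zero) ∧ x = 0) ∨
    (L = mkLine 0 1 0 (Or.inr (Or.inl one_ne_zero)) ∧ y = 0) ∨
    (L = mkLine 0 0 1 (Or.inr (Or.inr one_ne_zero)) ∧ z = 0) ∨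
    (∃ ζ : ℂ, L = mkLine 1 (-ζ) 0 (Or.inl one_ne_zero) ∧ ζ ≠ 0 ∧ ζ ^ n = 1 ∧ x = ζ * y ∧
      x ^ n = y ^ n) ∨
    (∃ ζ : ℂ, L = mkLine 1 0 (-ζ) (Or.inl one_ne_zero) ∧ ζ ≠ 0 ∧ ζ ^ n = 1 ∧ x = ζ * z ∧
      x ^ n = z ^ n) ∨
    (∃ ζ : ℂ, L = mkLine 0 (-ζ) 1 (Or.inr (Or.inr one_ne_zero)) ∧ ζ ≠ 0 ∧ ζ ^ n = 1 ∧
      z = ζ * y ∧ z ^ n = y ^ n ∧ 0 < k) := by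
  rw [mem_arrW hn] at hL
  rcases hL with rfl | rfl | rfl | ⟨ζ, h1, rfl⟩ | ⟨ζ, h1, rfl⟩ | ⟨j, hj, rfl⟩ <;>
    rw [pointOnLine_coord] at hp
  · exact Or.inl ⟨rfl, by linear_combination hp⟩
  · exact Or.inr (Or.inl ⟨rfl, by linear_combination hp⟩)
  · exact Or.inr (Or.inr (Or.inl ⟨rfl, by linear_combination hp⟩))
  · have e : x = ζ * y := by linear_combination hp
    exact Or.inr (Or.inr (Or.inr (Or.inl ⟨ζ, rfl, root_ne_zero hn h1, h1, e,
      by rw [e, mul_pow, h1, one_mul]⟩)))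
  · have e : x = ζ * z := by linear_combination hp
    exact Or.inr (Or.inr (Or.inr (Or.inr (Or.inl ⟨ζ, rfl, root_ne_zero hn h1, h1, e,
      by rw [e, mul_pow, h1, one_mul]⟩))))
  · have h1 := hw.1 j hj
    have e : z = w j * y := by linear_combination hp
    exact Or.inr (Or.inr (Or.inr (Or.inr (Or.inr ⟨w j, rfl, root_ne_zero hn h1, h1, e,
      by rw [e, mul_pow, h1, one_mul], by omega⟩))))

/-- Coordinates of intersection points of `arrW`. -/
lemma arrW_int {n k : ℕ} (hn : 0 < n) {w : ℕ → ℂ} (hw : IsWTuple n k w) {x y z : ℂ}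
    (h : x ≠ 0 ∨ y ≠ 0 ∨ z ≠ 0) (hp : IsIntersectionPoint (arrW n k w) (mkPoint x y z h)) :
    (x = 0 ∨ y = 0 ∨ x ^ n = y ^ n) ∧ (x = 0 ∨ z = 0 ∨ x ^ n = z ^ n) ∧
      (y = 0 ∨ z = 0 ∨ z ^ n = y ^ n) := by
  obtain ⟨L, hL, L', hL', hne, h1, h2⟩ := isInt_iff.1 hp
  rcases arrW_through hn hw h hL h1 with ⟨e, f⟩ | ⟨e, f⟩ | ⟨e, f⟩ | ⟨ζ, e, f, _, f', f''⟩ |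
      ⟨ζ, e, f, _, f', f''⟩ | ⟨ζ, e, f, _, f', f'', _⟩ <;>
    rcases arrW_through hn hw h hL' h2 with ⟨e', g⟩ | ⟨e', g⟩ | ⟨e', g⟩ | ⟨ξ, e', g, _, g', g''⟩ |
      ⟨ξ, e', g, _, g', g''⟩ | ⟨ξ, e', g, _, g', g'', _⟩ <;> grind

lemma ptP_modular {n : ℕ} (hn : 0 < n) {w : ℕ → ℂ} (hw : IsWTuple n n w) :
    IsModular (arrW n n w) ptP := by
  refine ⟨isInt_iff.2 ⟨mkLine 1 0 0 (Or.inl one_ne_zero), (mem_arrW hn).2 (by tauto),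
    mkLine 0 1 0 (Or.inr (Or.inl one_ne_zero)), (mem_arrW hn).2 (by tauto), ?_, ?_, ?_⟩, ?_⟩
  · simp [mkLine_eq_iff]
  · simp [ptP, pointOnLine_coord]
  · simp [ptP, pointOnLine_coord]
  intro q hq _
  obtain ⟨x, y, z, h, rfl⟩ := exists_mkPoint q
  by_cases hx : x = 0
  · exact ⟨mkLine 1 0 0 (Or.inl one_ne_zero), (mem_arrW hn).2 (by tauto),
      by simp [ptP, pointOnLine_coord], by simp [pointOnLine_coord, hx]⟩
  by_cases hy : y = 0
  · exact ⟨mkLine 0 1 0 (Or.inr (Or.inl one_ne_zero)), (mem_arrW hn).2 (by tauto),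
      by simp [ptP, pointOnLine_coord], by simp [pointOnLine_coord, hy]⟩
  have key : x ^ n = y ^ n := by
    have := (arrW_int hn hw h hq).1
    tauto
  refine ⟨mkLine 1 (-(x / y)) 0 (Or.inl one_ne_zero), (mem_arrW hn).2
    (Or.inr (Or.inr (Or.inr (Or.inl ⟨x / y, ?_, rfl⟩)))), ?_, ?_⟩
  · rw [div_pow, key, div_self (pow_ne_zero n hy)]
  · simp [ptP, pointOnLine_coord]
  · simp [pointOnLine_coord, hy]

lemma ptQ_modular {n : ℕ} (hn : 0 < n) {w : ℕ → ℂ} (hw : IsWTuple n n w) :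
    IsModular (arrW n n w) ptQ := by
  refine ⟨isInt_iff.2 ⟨mkLine 1 0 0 (Or.inl one_ne_zero), (mem_arrW hn).2 (by tauto),
    mkLine 0 0 1 (Or.inr (Or.inr one_ne_zero)), (mem_arrW hn).2 (by tauto), ?_, ?_, ?_⟩, ?_⟩
  · simp [mkLine_eq_iff]
  · simp [ptQ, pointOnLine_coord]
  · simp [ptQ, pointOnLine_coord]
  intro q hq _
  obtain ⟨x, y, z, h, rfl⟩ := exists_mkPoint q
  by_cases hx : x = 0
  · exact ⟨mkLine 1 0 0 (Or.inl one_ne_zero), (mem_arrW hn).2 (by tauto),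
      by simp [ptQ, pointOnLine_coord], by simp [pointOnLine_coord, hx]⟩
  by_cases hz : z = 0
  · exact ⟨mkLine 0 0 1 (Or.inr (Or.inr one_ne_zero)), (mem_arrW hn).2 (by tauto),
      by simp [ptQ, pointOnLine_coord], by simp [pointOnLine_coord, hz]⟩
  have key : x ^ n = z ^ n := by
    have := (arrW_int hn hw h hq).2.1
    tauto
  refine ⟨mkLine 1 0 (-(x / z)) (Or.inl one_ne_zero), (mem_arrW hn).2
    (Or.inr (Or.inr (Or.inr (Or.inr (Or.inl ⟨x / z, ?_, rfl⟩))))), ?_, ?_⟩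
  · rw [div_pow, key, div_self (pow_ne_zero n hz)]
  · simp [ptQ, pointOnLine_coord]
  · simp [pointOnLine_coord, hz]

lemma ptR_modular {n : ℕ} (hn : 0 < n) {w : ℕ → ℂ} (hw : IsWTuple n n w) :
    IsModular (arrW n n w) ptR := by
  refine ⟨isInt_iff.2 ⟨mkLine 0 1 0 (Or.inr (Or.inl one_ne_zero)), (mem_arrW hn).2 (by tauto),
    mkLine 0 0 1 (Or.inr (Or.inr one_ne_zero)), (mem_arrW hn).2 (by tauto), ?_, ?_, ?_⟩, ?_⟩
  · simp [mkLine_eq_iff]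
  · simp [ptR, pointOnLine_coord]
  · simp [ptR, pointOnLine_coord]
  intro q hq _
  obtain ⟨x, y, z, h, rfl⟩ := exists_mkPoint q
  by_cases hy : y = 0
  · exact ⟨mkLine 0 1 0 (Or.inr (Or.inl one_ne_zero)), (mem_arrW hn).2 (by tauto),
      by simp [ptR, pointOnLine_coord], by simp [pointOnLine_coord, hy]⟩
  by_cases hz : z = 0
  · exact ⟨mkLine 0 0 1 (Or.inr (Or.inr one_ne_zero)), (mem_arrW hn).2 (by tauto),
      by simp [ptR, pointOnLine_coord], by simp [pointOnLine_coord, hz]⟩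
  have key : z ^ n = y ^ n := by
    have := (arrW_int hn hw h hq).2.2
    tauto
  obtain ⟨j, hj, hwj⟩ := w_surj hn hw (ζ := z / y)
    (by rw [div_pow, key, div_self (pow_ne_zero n hy)])
  refine ⟨mkLine 0 (-(w j)) 1 (Or.inr (Or.inr one_ne_zero)), (mem_arrW hn).2
    (Or.inr (Or.inr (Or.inr (Or.inr (Or.inr ⟨j, hj, rfl⟩))))), ?_, ?_⟩
  · simp [ptR, pointOnLine_coord]
  · simp [pointOnLine_coord, hwj, hy]

lemma ptD_modular {w : ℕ → ℂ} (hw : IsWTuple 1 1 w) :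
    IsModular (arrW 1 1 w) ptD := by
  have hn : 0 < 1 := one_pos
  have hw0 : w 0 = 1 := by simpa using hw.1 0 one_pos
  have m1 : mkLine 1 (-1) 0 (Or.inl one_ne_zero) ∈ arrW 1 1 w :=
    (mem_arrW hn).2 (Or.inr (Or.inr (Or.inr (Or.inl ⟨1, by simp, rfl⟩))))
  have m2 : mkLine 1 0 (-1) (Or.inl one_ne_zero) ∈ arrW 1 1 w :=
    (mem_arrW hn).2 (Or.inr (Or.inr (Or.inr (Or.inr (Or.inl ⟨1, by simp, rfl⟩)))))
  have m3 : mkLine 0 (-1) 1 (Or.inr (Or.inr one_ne_zero)) ∈ arrW 1 1 w :=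
    (mem_arrW hn).2 (Or.inr (Or.inr (Or.inr (Or.inr (Or.inr ⟨0, one_pos, by simp [hw0]⟩)))))
  refine ⟨isInt_iff.2 ⟨_, m1, _, m2, ?_, ?_, ?_⟩, ?_⟩
  · simp [mkLine_eq_iff]
  · simp [ptD, pointOnLine_coord]
  · simp [ptD, pointOnLine_coord]
  intro q hq _
  obtain ⟨x, y, z, h, rfl⟩ := exists_mkPoint q
  have key := arrW_int hn hw h hq
  simp only [pow_one] at key
  have : x = y ∨ x = z ∨ z = y := by grind
  rcases this with e | e | e
  · exact ⟨_, m1, by simp [ptD, pointOnLine_coord], by simp [pointOnLine_coord, e]⟩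
  · exact ⟨_, m2, by simp [ptD, pointOnLine_coord], by simp [pointOnLine_coord, e]⟩
  · exact ⟨_, m3, by simp [ptD, pointOnLine_coord], by simp [pointOnLine_coord, e]⟩

lemma ncard_le_two {α : Type*} {S : Set α} (a b : α) (h : S ⊆ {a, b}) : S.ncard ≤ 2 :=
  (Set.ncard_le_ncard h (Set.toFinite _)).trans
    ((Set.ncard_insert_le a {b}).trans (by rw [Set.ncard_singleton]))

lemma subsingleton_through {q X : ProjPoint} (h : q ≠ X) :
    {L : ProjLine | PointOnLine q L ∧ PointOnLine X L}.Subsingleton := by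
  intro L hL L' hL'
  exact (eq_or_eq' hL.1 hL.2 hL'.1 hL'.2).resolve_left h

lemma arrW_through_vertex {n k : ℕ} (hn : 0 < n) {w : ℕ → ℂ} {L : ProjLine}
    (hL : L ∈ arrW n k w) : PointOnLine ptP L ∨ PointOnLine ptQ L ∨ (PointOnLine ptR L ∧ 0 < k) := by
  rw [mem_arrW hn] at hL
  rcases hL with rfl | rfl | rfl | ⟨ζ, h1, rfl⟩ | ⟨ζ, h1, rfl⟩ | ⟨j, hj, rfl⟩ <;>
    simp [ptP, ptQ, ptR, pointOnLine_coord]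
  omega

lemma mult_le_three {n k : ℕ} (hn : 0 < n) {w : ℕ → ℂ} {q : ProjPoint} (hP : q ≠ ptP)
    (hQ : q ≠ ptQ) (hR : q ≠ ptR) :
    mult (arrW n k w) q ≤ 3 ∧ (k = 0 → mult (arrW n k w) q ≤ 2) := by
  unfold mult
  set SP := {L : ProjLine | PointOnLine q L ∧ PointOnLine ptP L} with hSP
  set SQ := {L : ProjLine | PointOnLine q L ∧ PointOnLine ptQ L} with hSQ
  set SR := {L : ProjLine | PointOnLine q L ∧ PointOnLine ptR L} with hSR
  have sP := subsingleton_through hP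
  have sQ := subsingleton_through hQ
  have sR := subsingleton_through hR
  have cP : SP.ncard ≤ 1 := (Set.ncard_le_one sP.finite).2 fun a ha b hb => sP ha hb
  have cQ : SQ.ncard ≤ 1 := (Set.ncard_le_one sQ.finite).2 fun a ha b hb => sQ ha hb
  have cR : SR.ncard ≤ 1 := (Set.ncard_le_one sR.finite).2 fun a ha b hb => sR ha hb
  have u1 := Set.ncard_union_le SP SQ
  have u2 := Set.ncard_union_le (SP ∪ SQ) SR
  constructor
  · refine (Set.ncard_le_ncard (t := SP ∪ SQ ∪ SR) ?_
      ((sP.finite.union sQ.finite).union sR.finite)).trans (by omega)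
    rintro L ⟨hL, hq⟩
    rcases arrW_through_vertex hn hL with h | h | h
    · exact Or.inl (Or.inl ⟨hq, h⟩)
    · exact Or.inl (Or.inr ⟨hq, h⟩)
    · exact Or.inr ⟨hq, h.1⟩
  · rintro rfl
    refine (Set.ncard_le_ncard (t := SP ∪ SQ) ?_ (sP.finite.union sQ.finite)).trans (by omega)
    rintro L ⟨hL, hq⟩
    rcases arrW_through_vertex hn hL with h | h | h
    · exact Or.inl ⟨hq, h⟩
    · exact Or.inr ⟨hq, h⟩
    · exact absurd h.2 (lt_irrefl _)

lemma mult_ptR_le {n k : ℕ} (hn : 0 < n) {w : ℕ → ℂ} :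
    mult (arrW n k w) ptR ≤ k + 2 := by
  unfold mult
  set F : Finset ProjLine := {mkLine 0 1 0 (Or.inr (Or.inl one_ne_zero)),
    mkLine 0 0 1 (Or.inr (Or.inr one_ne_zero))} ∪ ((Finset.range k).image fun j =>
    mkLine 0 (-(w j)) 1 (Or.inr (Or.inr one_ne_zero))) with hF
  have hc : F.card ≤ k + 2 := by
    refine (Finset.card_union_le _ _).trans ?_
    have h1 := Finset.card_le_two (a := mkLine 0 1 0 (Or.inr (Or.inl one_ne_zero)))
      (b := mkLine 0 0 1 (Or.inr (Or.inr one_ne_zero)))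
    have h2 := Finset.card_image_le (s := Finset.range k) (f := fun j =>
      mkLine 0 (-(w j)) 1 (Or.inr (Or.inr one_ne_zero)))
    rw [Finset.card_range] at h2
    omega
  refine le_trans ?_ hc
  rw [← Set.ncard_coe_finset]
  refine Set.ncard_le_ncard ?_ F.finite_toSet
  rintro L ⟨hL, hq⟩
  rw [mem_arrW hn] at hL
  rw [hF]
  rcases hL with rfl | rfl | rfl | ⟨ζ, h1, rfl⟩ | ⟨ζ, h1, rfl⟩ | ⟨j, hj, rfl⟩
  · simp [ptR, pointOnLine_coord] at hq
  · simp
  · simp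
  · simp [ptR, pointOnLine_coord] at hq
  · simp [ptR, pointOnLine_coord] at hq
  · simp only [Finset.coe_union, Finset.coe_image]
    exact Or.inr ⟨j, by simpa using hj, rfl⟩

lemma eq_ptD {w : ℕ → ℂ} (hw : IsWTuple 1 1 w) {q : ProjPoint} (hP : q ≠ ptP)
    (hQ : q ≠ ptQ) (hR : q ≠ ptR) (hq : mult (arrW 1 1 w) q = 3) : q = ptD := by
  obtain ⟨x, y, z, h, rfl⟩ := exists_mkPoint q
  unfold ptP at hP
  unfold ptQ at hQ
  unfold ptR at hR
  unfold ptD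
  rw [Ne, mkPoint_eq_iff] at hP hQ hR
  rw [mkPoint_eq_iff]
  by_contra hc
  simp at hP hQ hR hc
  have key : ∀ a b : ProjLine, (∀ L ∈ arrW 1 1 w, PointOnLine (mkPoint x y z h) L →
      L = a ∨ L = b) → False := by
    intro a b hab
    have : mult (arrW 1 1 w) (mkPoint x y z h) ≤ 2 :=
      ncard_le_two a b fun L hL => hab L hL.1 hL.2
    omega
  have thr := fun L hL hp => arrW_through one_pos hw h (L := L) hL hp
  simp only [pow_one] at thr
  by_cases hx : x = 0
  · apply key (mkLine 1 0 0 (Or.inl one_ne_zero)) (mkLine 0 (-1) 1 (Or.inr (Or.inr one_ne_zero)))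
    intro L hL hp
    have := thr L hL hp
    grind
  by_cases hy : y = 0
  · apply key (mkLine 0 1 0 (Or.inr (Or.inl one_ne_zero))) (mkLine 1 0 (-1) (Or.inl one_ne_zero))
    intro L hL hp
    have := thr L hL hp
    grind
  by_cases hz : z = 0
  · apply key (mkLine 0 0 1 (Or.inr (Or.inr one_ne_zero))) (mkLine 1 (-1) 0 (Or.inl one_ne_zero))
    intro L hL hp
    have := thr L hL hp
    grind
  by_cases hxy : x = y
  · apply key (mkLine 1 (-1) 0 (Or.inl one_ne_zero)) (mkLine 1 (-1) 0 (Or.inl one_ne_zero))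
    intro L hL hp
    have := thr L hL hp
    grind
  · apply key (mkLine 1 0 (-1) (Or.inl one_ne_zero))
      (mkLine 0 (-1) 1 (Or.inr (Or.inr one_ne_zero)))
    intro L hL hp
    have := thr L hL hp
    grind

/-! ### Projective transformations -/

/-- The action of a linear automorphism on points. -/
def pointMap (T : (Fin 3 → ℂ) ≃ₗ[ℂ] (Fin 3 → ℂ)) : ProjPoint → ProjPoint :=
  Projectivization.map (T : (Fin 3 → ℂ) →ₗ[ℂ] (Fin 3 → ℂ)) T.injective

lemma lineMap_injective (T : (Fin 3 → ℂ) ≃ₗ[ℂ] (Fin 3 → ℂ)) : Function.Injective (lineMap T) :=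
  Projectivization.map_injective _ _

lemma pointMap_injective (T : (Fin 3 → ℂ) ≃ₗ[ℂ] (Fin 3 → ℂ)) : Function.Injective (pointMap T) :=
  Projectivization.map_injective _ _

lemma pointMap_surjective (T : (Fin 3 → ℂ) ≃ₗ[ℂ] (Fin 3 → ℂ)) :
    Function.Surjective (pointMap T) := by
  intro q
  induction q using Projectivization.ind with
  | h v hv =>
    refine ⟨Projectivization.mk ℂ (T.symm v) (by simpa using hv), ?_⟩
    unfold pointMap
    rw [Projectivization.map_mk]
    congr 1
    simp

lemma inc_map (T : (Fin 3 → ℂ) ≃ₗ[ℂ] (Fin 3 → ℂ)) (p : ProjPoint) (L : ProjLine) :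
    PointOnLine p L ↔ PointOnLine (pointMap T p) (lineMap T L) := by
  induction p using Projectivization.ind with
  | h v hv =>
    induction L using Projectivization.ind with
    | h f hf =>
      unfold pointMap lineMap
      rw [Projectivization.map_mk, Projectivization.map_mk, pointOnLine_mk, pointOnLine_mk]
      simp

lemma cIso_map (T : (Fin 3 → ℂ) ≃ₗ[ℂ] (Fin 3 → ℂ)) (A : Finset ProjLine) :
    CIso A (A.image (lineMap T)) (lineMap T) (pointMap T) := by
  refine ⟨⟨?_, (lineMap_injective T).injOn, ?_⟩, ⟨?_, (pointMap_injective T).injOn, ?_⟩,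
    fun p _ L _ => inc_map T p L⟩
  · intro L hL
    exact Finset.mem_coe.2 (Finset.mem_image_of_mem _ hL)
  · intro L hL
    obtain ⟨M, hM, rfl⟩ := Finset.mem_image.1 (Finset.mem_coe.1 hL)
    exact ⟨M, hM, rfl⟩
  · intro p hp
    obtain ⟨L1, h1, L2, h2, hne, hp1, hp2⟩ := isInt_iff.1 hp
    exact isInt_iff.2 ⟨_, Finset.mem_image_of_mem _ h1, _, Finset.mem_image_of_mem _ h2,
      fun hc => hne (lineMap_injective T hc), (inc_map T p L1).1 hp1, (inc_map T p L2).1 hp2⟩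
  · intro q hq
    obtain ⟨p, rfl⟩ := pointMap_surjective T q
    obtain ⟨M1, h1, M2, h2, hne, hp1, hp2⟩ := isInt_iff.1 hq
    obtain ⟨L1, g1, rfl⟩ := Finset.mem_image.1 h1
    obtain ⟨L2, g2, rfl⟩ := Finset.mem_image.1 h2
    exact ⟨p, isInt_iff.2 ⟨L1, g1, L2, g2, fun hc => hne (by rw [hc]), (inc_map T p L1).2 hp1,
      (inc_map T p L2).2 hp2⟩, rfl⟩

lemma exists_frame {p q r : ProjPoint}
    (hnc : ¬ ∃ L, PointOnLine p L ∧ PointOnLine q L ∧ PointOnLine r L) {La Lb : ProjLine}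
    (ap : PointOnLine p La) (aq : ¬ PointOnLine q La) (ar : ¬ PointOnLine r La)
    (bq : PointOnLine q Lb) (bp : ¬ PointOnLine p Lb) (br : ¬ PointOnLine r Lb) :
    ∃ T, pointMap T p = ptP ∧ pointMap T q = ptQ ∧ pointMap T r = ptR ∧
      lineMap T La = mkLine 1 (-1) 0 (Or.inl one_ne_zero) ∧
      lineMap T Lb = mkLine 1 0 (-1) (Or.inl one_ne_zero) := by
  induction p using Projectivization.ind with | h p hp =>
  induction q using Projectivization.ind with | h q hq =>
  induction r using Projectivization.ind with | h r hr =>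
  induction La using Projectivization.ind with | h f hf =>
  induction Lb using Projectivization.ind with | h g hg =>
  rw [pointOnLine_mk] at ap aq ar bp bq br
  set β : ℂ := -(f r) / f q with hβ
  set γ : ℂ := -(g r) / g p with hγ
  have hβ0 : β ≠ 0 := div_ne_zero (neg_ne_zero.2 ar) aq
  have hγ0 : γ ≠ 0 := div_ne_zero (neg_ne_zero.2 br) bp
  set M : Matrix (Fin 3) (Fin 3) ℂ := ![r, β • q, γ • p] with hM
  have hli : LinearIndependent ℂ M.row := by
    rw [Matrix.linearIndependent_rows_iff_isUnit, Matrix.isUnit_iff_isUnit_det, isUnit_iff_ne_zero]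
    intro hdet
    obtain ⟨v, hv, hMv⟩ := Matrix.exists_mulVec_eq_zero_iff.2 hdet
    have hv' : v 0 ≠ 0 ∨ v 1 ≠ 0 ∨ v 2 ≠ 0 := by
      by_contra! hc
      apply hv
      ext i
      fin_cases i <;> simp [hc]
    have e0 := congrFun hMv 0
    have e1 := congrFun hMv 1
    have e2 := congrFun hMv 2
    simp [hM, Matrix.mulVec, dotProduct, Fin.sum_univ_three] at e0 e1 e2
    apply hnc
    refine ⟨mkLine (v 0) (v 1) (v 2) hv', ?_, ?_, ?_⟩ <;> unfold mkLine <;>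
      rw [pointOnLine_mk, mkForm_apply]
    · apply mul_left_cancel₀ hγ0
      linear_combination e2
    · apply mul_left_cancel₀ hβ0
      linear_combination e1
    · linear_combination e0
  set b := basisOfLinearIndependentOfCardEqFinrank hli (by simp) with hb
  have b0 : b 0 = r := by simp [hb, hM, Matrix.row]
  have b1 : b 1 = β • q := by simp [hb, hM, Matrix.row]
  have b2 : b 2 = γ • p := by simp [hb, hM, Matrix.row]
  have line : ∀ (l : Module.Dual ℂ (Fin 3 → ℂ)) (hl : l ≠ 0) (x y z : ℂ) (h), l (b 0) = x →
      l (b 1) = y → l (b 2) = z →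
      lineMap b.equivFun (Projectivization.mk ℂ l hl) = mkLine x y z h := by
    rintro l hl x y z h rfl rfl rfl
    unfold lineMap mkLine
    rw [Projectivization.map_mk]
    congr 1
    apply LinearMap.pi_ext'
    intro i
    ext
    fin_cases i <;> simp [mkForm_apply]
  have t0 : b.equivFun r = ![1, 0, 0] := by
    rw [← b0]; ext i; fin_cases i <;> simp
  have t1 : b.equivFun (β • q) = ![0, 1, 0] := by
    rw [← b1]; ext i; fin_cases i <;> simp
  have t2 : b.equivFun (γ • p) = ![0, 0, 1] := by
    rw [← b2]; ext i; fin_cases i <;> simp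
  refine ⟨b.equivFun, ?_, ?_, ?_, ?_, ?_⟩
  · unfold pointMap ptP mkPoint
    rw [Projectivization.map_mk, Projectivization.mk_eq_mk_iff']
    refine ⟨γ⁻¹, ?_⟩
    rw [← t2, map_smul, smul_smul, inv_mul_cancel₀ hγ0, one_smul]
    rfl
  · unfold pointMap ptQ mkPoint
    rw [Projectivization.map_mk, Projectivization.mk_eq_mk_iff']
    refine ⟨β⁻¹, ?_⟩
    rw [← t1, map_smul, smul_smul, inv_mul_cancel₀ hβ0, one_smul]
    rfl
  · unfold pointMap ptR mkPoint
    rw [Projectivization.map_mk, Projectivization.mk_eq_mk_iff']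
    refine ⟨1, ?_⟩
    rw [← t0, one_smul]
    rfl
  · rw [line f hf (f r) (-(f r)) 0 (Or.inl ar) (by rw [b0])
      (by rw [b1, map_smul, smul_eq_mul, hβ]; field_simp) (by rw [b2, map_smul, ap, smul_zero]),
      mkLine_eq_iff]
    simp
  · rw [line g hg (g r) 0 (-(g r)) (Or.inl br) (by rw [b0]) (by rw [b1, map_smul, bq, smul_zero])
      (by rw [b2, map_smul, smul_eq_mul, hγ]; field_simp), mkLine_eq_iff]
    simp

/-! ### Rigidity -/

lemma roots_of_closed {n : ℕ} {S : Set ℂ} (hn : 0 < n) (hS : S.ncard = n)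
    (h0 : ∀ s ∈ S, s ≠ 0) (hmul : ∀ s ∈ S, ∀ t ∈ S, s * t ∈ S) (ζ : ℂ) : ζ ∈ S ↔ ζ ^ n = 1 := by
  have hfin : S.Finite := Set.finite_of_ncard_ne_zero (by omega)
  set F := hfin.toFinset with hF
  have hFc : F.card = n := by rw [← hS, Set.ncard_eq_toFinset_card S hfin]
  have hmem : ∀ x, x ∈ F ↔ x ∈ S := fun x => hfin.mem_toFinset
  have hpow : ∀ s ∈ F, s ^ n = 1 := by
    intro s hs
    have hs0 := h0 s ((hmem s).1 hs)
    have him : F.image (fun t => s * t) = F := by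
      apply Finset.eq_of_subset_of_card_le
      · intro x hx
        obtain ⟨t, ht, rfl⟩ := Finset.mem_image.1 hx
        exact (hmem _).2 (hmul s ((hmem s).1 hs) t ((hmem t).1 ht))
      · rw [Finset.card_image_of_injective _ (mul_right_injective₀ hs0)]
    have hprod : ∏ t ∈ F, t = s ^ n * ∏ t ∈ F, t := by
      conv_lhs => rw [← him]
      rw [Finset.prod_image (fun a _ b _ hab => mul_right_injective₀ hs0 hab),
        Finset.prod_mul_distrib, Finset.prod_const, hFc]
    have hne : ∏ t ∈ F, t ≠ 0 := Finset.prod_ne_zero_iff.2 fun t ht => h0 t ((hmem t).1 ht)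
    exact (mul_right_cancel₀ hne (by rw [one_mul]; exact hprod)).symm
  have hsub : F ⊆ (Polynomial.nthRoots n (1 : ℂ)).toFinset := by
    intro x hx
    rw [Multiset.mem_toFinset, Polynomial.mem_nthRoots hn]
    exact hpow x hx
  have heq := Finset.eq_of_subset_of_card_le hsub (by
    rw [hFc]
    exact (Multiset.toFinset_card_le _).trans (Polynomial.card_nthRoots n 1))
  rw [← hmem, heq, Multiset.mem_toFinset, Polynomial.mem_nthRoots hn]

lemma lines_ptP {L : ProjLine} (h : PointOnLine ptP L) :
    L = mkLine 1 0 0 (Or.inl one_ne_zero) ∨ L = mkLine 0 1 0 (Or.inr (Or.inl one_ne_zero)) ∨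
    ∃ a : ℂ, a ≠ 0 ∧ L = mkLine 1 (-a) 0 (Or.inl one_ne_zero) := by
  obtain ⟨a, b, c, g, rfl⟩ := exists_mkLine L
  rw [ptP, pointOnLine_coord] at h
  have hc : c = 0 := by linear_combination h
  subst hc
  by_cases hb : b = 0
  · left; simp [mkLine_eq_iff, hb]
  by_cases ha : a = 0
  · right; left; simp [mkLine_eq_iff, ha]
  · right; right
    refine ⟨-b / a, div_ne_zero (neg_ne_zero.2 hb) ha, ?_⟩
    simp [mkLine_eq_iff]
    field_simp

lemma lines_ptQ {L : ProjLine} (h : PointOnLine ptQ L) :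
    L = mkLine 1 0 0 (Or.inl one_ne_zero) ∨ L = mkLine 0 0 1 (Or.inr (Or.inr one_ne_zero)) ∨
    ∃ a : ℂ, a ≠ 0 ∧ L = mkLine 1 0 (-a) (Or.inl one_ne_zero) := by
  obtain ⟨a, b, c, g, rfl⟩ := exists_mkLine L
  rw [ptQ, pointOnLine_coord] at h
  have hc : b = 0 := by linear_combination h
  subst hc
  by_cases hb : c = 0
  · left; simp [mkLine_eq_iff, hb]
  by_cases ha : a = 0
  · right; left; simp [mkLine_eq_iff, ha]
  · right; right
    refine ⟨-c / a, div_ne_zero (neg_ne_zero.2 hb) ha, ?_⟩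
    simp [mkLine_eq_iff]
    field_simp

lemma lines_ptR {L : ProjLine} (h : PointOnLine ptR L) :
    L = mkLine 0 1 0 (Or.inr (Or.inl one_ne_zero)) ∨
    L = mkLine 0 0 1 (Or.inr (Or.inr one_ne_zero)) ∨
    ∃ a : ℂ, a ≠ 0 ∧ L = mkLine 0 1 (-a) (Or.inr (Or.inl one_ne_zero)) := by
  obtain ⟨a, b, c, g, rfl⟩ := exists_mkLine L
  rw [ptR, pointOnLine_coord] at h
  have hc : a = 0 := by linear_combination h
  subst hc
  by_cases hb : c = 0
  · left; simp [mkLine_eq_iff, hb]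
  by_cases ha : b = 0
  · right; left; simp [mkLine_eq_iff, ha]
  · right; right
    refine ⟨-c / b, div_ne_zero (neg_ne_zero.2 hb) ha, ?_⟩
    simp [mkLine_eq_iff]
    field_simp

lemma monomial_subset {m : ℕ} (hm : 3 ≤ m) {A : Finset ProjLine} (hP : IsModular A ptP)
    (hQ : IsModular A ptQ) (hR : IsModular A ptR) (hmQ : mult A ptQ = m)
    (ha1 : mkLine 1 (-1) 0 (Or.inl one_ne_zero) ∈ A)
    (hb1 : mkLine 1 0 (-1) (Or.inl one_ne_zero) ∈ A) : monomialArr m ⊆ A := by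
  have hX : mkLine 1 0 0 (Or.inl one_ne_zero) ∈ A := by
    obtain ⟨L, hL, h1, h2⟩ := hP.2 ptQ hQ.1 (by simp [ptP, ptQ, mkPoint_eq_iff])
    have := (eq_or_eq' h1 h2 (L' := mkLine 1 0 0 (Or.inl one_ne_zero))
      (by simp [ptP, pointOnLine_coord]) (by simp [ptQ, pointOnLine_coord])).resolve_left
      (by simp [ptP, ptQ, mkPoint_eq_iff])
    exact this ▸ hL
  have hY : mkLine 0 1 0 (Or.inr (Or.inl one_ne_zero)) ∈ A := by
    obtain ⟨L, hL, h1, h2⟩ := hP.2 ptR hR.1 (by simp [ptP, ptR, mkPoint_eq_iff])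
    have := (eq_or_eq' h1 h2 (L' := mkLine 0 1 0 (Or.inr (Or.inl one_ne_zero)))
      (by simp [ptP, pointOnLine_coord]) (by simp [ptR, pointOnLine_coord])).resolve_left
      (by simp [ptP, ptR, mkPoint_eq_iff])
    exact this ▸ hL
  have hZ : mkLine 0 0 1 (Or.inr (Or.inr one_ne_zero)) ∈ A := by
    obtain ⟨L, hL, h1, h2⟩ := hQ.2 ptR hR.1 (by simp [ptQ, ptR, mkPoint_eq_iff])
    have := (eq_or_eq' h1 h2 (L' := mkLine 0 0 1 (Or.inr (Or.inr one_ne_zero)))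
      (by simp [ptQ, pointOnLine_coord]) (by simp [ptR, pointOnLine_coord])).resolve_left
      (by simp [ptQ, ptR, mkPoint_eq_iff])
    exact this ▸ hL
  set Sa : Set ℂ := {a | a ≠ 0 ∧ mkLine 1 (-a) 0 (Or.inl one_ne_zero) ∈ A} with hSa
  set Sb : Set ℂ := {a | a ≠ 0 ∧ mkLine 1 0 (-a) (Or.inl one_ne_zero) ∈ A} with hSb
  set Sc : Set ℂ := {a | a ≠ 0 ∧ mkLine 0 1 (-a) (Or.inr (Or.inl one_ne_zero)) ∈ A} with hSc
  have a1 : (1 : ℂ) ∈ Sa := ⟨one_ne_zero, ha1⟩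
  have b1 : (1 : ℂ) ∈ Sb := ⟨one_ne_zero, hb1⟩
  have cab : ∀ a ∈ Sa, ∀ b ∈ Sb, b / a ∈ Sc := by
    rintro a ⟨a0, ha⟩ b ⟨b0, hb⟩
    refine ⟨div_ne_zero b0 a0, ?_⟩
    have hne : (a * b ≠ 0 ∨ b ≠ 0 ∨ a ≠ 0) := Or.inr (Or.inl b0)
    obtain ⟨L, hL, h1, h2⟩ := hR.2 (mkPoint (a * b) b a hne)
      (isInt_iff.2 ⟨_, ha, _, hb, by simp [mkLine_eq_iff, a0],
        by simp [pointOnLine_coord], by rw [pointOnLine_coord]; ring⟩)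
      (by simp only [ptR, Ne, mkPoint_eq_iff]; simp [b0.symm])
    rcases lines_ptR h1 with rfl | rfl | ⟨c, c0, rfl⟩ <;> rw [pointOnLine_coord] at h2
    · exact absurd (by linear_combination h2) b0
    · exact absurd (by linear_combination h2) a0
    · have : b / a = c := by field_simp; linear_combination h2
      exact this ▸ hL
  have bac : ∀ a ∈ Sa, ∀ c ∈ Sc, a * c ∈ Sb := by
    rintro a ⟨a0, ha⟩ c ⟨c0, hc⟩
    refine ⟨mul_ne_zero a0 c0, ?_⟩
    have hne : (a * c ≠ 0 ∨ c ≠ 0 ∨ (1 : ℂ) ≠ 0) := Or.inr (Or.inl c0)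
    obtain ⟨L, hL, h1, h2⟩ := hQ.2 (mkPoint (a * c) c 1 hne)
      (isInt_iff.2 ⟨_, ha, _, hc, by simp [mkLine_eq_iff],
        by simp [pointOnLine_coord], by simp [pointOnLine_coord]⟩)
      (by simp [ptQ, mkPoint_eq_iff])
    rcases lines_ptQ h1 with rfl | rfl | ⟨b, b0, rfl⟩ <;> rw [pointOnLine_coord] at h2
    · exact absurd (by linear_combination h2) (mul_ne_zero a0 c0)
    · exact absurd (by linear_combination h2) (one_ne_zero (α := ℂ))
    · have : a * c = b := by linear_combination h2
      exact this ▸ hL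
  have abc : ∀ b ∈ Sb, ∀ c ∈ Sc, b / c ∈ Sa := by
    rintro b ⟨b0, hb⟩ c ⟨c0, hc⟩
    refine ⟨div_ne_zero b0 c0, ?_⟩
    have hne : (b ≠ 0 ∨ c ≠ 0 ∨ (1 : ℂ) ≠ 0) := Or.inr (Or.inl c0)
    obtain ⟨L, hL, h1, h2⟩ := hP.2 (mkPoint b c 1 hne)
      (isInt_iff.2 ⟨_, hb, _, hc, by simp [mkLine_eq_iff],
        by simp [pointOnLine_coord], by simp [pointOnLine_coord]⟩)
      (by simp [ptP, mkPoint_eq_iff, b0])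
    rcases lines_ptP h1 with rfl | rfl | ⟨a, a0, rfl⟩ <;> rw [pointOnLine_coord] at h2
    · exact absurd (by linear_combination h2) b0
    · exact absurd (by linear_combination h2) c0
    · have : b / c = a := by field_simp; linear_combination h2
      exact this ▸ hL
  have hbc : ∀ t, t ∈ Sb ↔ t ∈ Sc := fun t =>
    ⟨fun ht => by simpa using cab 1 a1 t ht, fun ht => by simpa using bac 1 a1 t ht⟩
  have hca : ∀ t ∈ Sc, t⁻¹ ∈ Sa := fun t ht => by simpa using abc 1 b1 t ht
  have hmul : ∀ s ∈ Sb, ∀ t ∈ Sb, s * t ∈ Sb := by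
    intro s hs t ht
    rw [hbc]
    simpa using cab _ (hca t ((hbc t).1 ht)) s hs
  have hinj : Function.Injective
      (fun a : ℂ => mkLine 1 0 (-a) (Or.inl one_ne_zero)) := by
    intro a b hab
    simp [mkLine_eq_iff] at hab
    exact hab.symm
  have hcard : Sb.ncard = m - 2 := by
    have hset : {L : ProjLine | L ∈ A ∧ PointOnLine ptQ L} =
        insert (mkLine 1 0 0 (Or.inl one_ne_zero)) (insert (mkLine 0 0 1
          (Or.inr (Or.inr one_ne_zero)))
          ((fun a : ℂ => mkLine 1 0 (-a) (Or.inl one_ne_zero)) '' Sb)) := by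
      ext L
      constructor
      · rintro ⟨hL, h⟩
        rcases lines_ptQ h with rfl | rfl | ⟨a, a0, rfl⟩
        · exact Or.inl rfl
        · exact Or.inr (Or.inl rfl)
        · exact Or.inr (Or.inr ⟨a, ⟨a0, hL⟩, rfl⟩)
      · rintro (rfl | rfl | ⟨a, ⟨a0, hL⟩, rfl⟩)
        · exact ⟨hX, by simp [ptQ, pointOnLine_coord]⟩
        · exact ⟨hZ, by simp [ptQ, pointOnLine_coord]⟩
        · exact ⟨hL, by simp [ptQ, pointOnLine_coord]⟩
    have hfin := finite_through A ptQ
    have hmQ' := hmQ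
    unfold mult at hmQ'
    rw [hset] at hmQ' hfin
    have f1 := hfin.subset (Set.subset_insert _ _)
    have f2 := f1.subset (Set.subset_insert _ _)
    rw [Set.ncard_insert_of_notMem _ f1, Set.ncard_insert_of_notMem _ f2,
      Set.ncard_image_of_injective _ hinj] at hmQ'
    · omega
    · rintro ⟨a, ⟨a0, _⟩, he⟩
      simp [mkLine_eq_iff] at he
    · rintro (he | ⟨a, ⟨a0, _⟩, he⟩)
      · simp [mkLine_eq_iff] at he
      · simp [mkLine_eq_iff, a0] at he
  have hroots := roots_of_closed (by omega) hcard (fun s hs => hs.1) hmul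
  intro L hL
  rw [mem_monomialArr hm] at hL
  rcases hL with rfl | rfl | rfl | ⟨ζ, h, rfl⟩ | ⟨ζ, h, rfl⟩ | ⟨ζ, h, rfl⟩
  · exact hX
  · exact hY
  · exact hZ
  · have h' : ζ⁻¹ ∈ Sb := (hroots _).2 (by rw [inv_pow, h, inv_one])
    have := hca _ ((hbc _).1 h')
    rw [inv_inv] at this
    exact this.2
  · exact ((hbc _).1 ((hroots _).2 h)).2
  · exact ((hroots _).2 h).2

/-- A line through `p` in `A`, avoiding `q` and `r`. -/
lemma exists_line_avoiding {A : Finset ProjLine} {p q r : ProjPoint} (hm : 3 ≤ mult A p)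
    (hpq : p ≠ q) (hpr : p ≠ r) :
    ∃ L ∈ A, PointOnLine p L ∧ ¬ PointOnLine q L ∧ ¬ PointOnLine r L := by
  by_contra! hc
  have s1 := subsingleton_through hpq
  have s2 := subsingleton_through hpr
  have c1 := (Set.ncard_le_one s1.finite).2 fun a ha b hb => s1 ha hb
  have c2 := (Set.ncard_le_one s2.finite).2 fun a ha b hb => s2 ha hb
  have u := Set.ncard_union_le {L : ProjLine | PointOnLine p L ∧ PointOnLine q L}
    {L : ProjLine | PointOnLine p L ∧ PointOnLine r L}
  have : mult A p ≤ 2 := by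
    unfold mult
    refine (Set.ncard_le_ncard ?_ (s1.finite.union s2.finite)).trans (u.trans (by omega))
    rintro L ⟨hL, hp⟩
    by_cases hq : PointOnLine q L
    · exact Or.inl ⟨hp, hq⟩
    · exact Or.inr ⟨hp, hc L hL hp hq⟩
  omega

lemma projEquiv_of_three {m : ℕ} (hm : 3 ≤ m) {A : Finset ProjLine} {p q r : ProjPoint}
    (hp : IsModular A p) (hq : IsModular A q) (hr : IsModular A r)
    (mp : mult A p = m) (mq : mult A q = m)
    (hpq : p ≠ q) (hpr : p ≠ r) (hqr : q ≠ r)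
    (hnc : ¬ ∃ L, PointOnLine p L ∧ PointOnLine q L ∧ PointOnLine r L)
    (hcard : A.card ≤ (monomialArr m).card) : ProjEquiv A (monomialArr m) := by
  obtain ⟨La, hLa, ap, aq, ar⟩ := exists_line_avoiding (by omega : 3 ≤ mult A p) hpq hpr
  obtain ⟨Lb, hLb, bq, bp, br⟩ := exists_line_avoiding (by omega : 3 ≤ mult A q) hpq.symm hqr
  obtain ⟨T, tp, tq, tr, ta, tb⟩ := exists_frame hnc ap aq ar bq bp br
  have e := cIso_map T A
  have hsub : monomialArr m ⊆ A.image (lineMap T) := by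
    apply monomial_subset hm
    · rw [← tp]; exact (e.modular_iff hp.1).2 hp
    · rw [← tq]; exact (e.modular_iff hq.1).2 hq
    · rw [← tr]; exact (e.modular_iff hr.1).2 hr
    · rw [← tq, e.mult_eq hq.1, mq]
    · rw [← ta]; exact Finset.mem_image_of_mem _ hLa
    · rw [← tb]; exact Finset.mem_image_of_mem _ hLb
  have heq := Finset.eq_of_subset_of_card_le hsub (Finset.card_image_le.trans hcard)
  refine ⟨T, ?_⟩
  rw [heq, Finset.coe_image]

/-- Let `A` be an `m`-homogeneous supersolvable line arrangement
(`m ≥ 3`) with at least two modular points, having the same intersection lattice as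
`A(w)` with `w ∈ W(m-2,k)`, `0 ≤ k ≤ m-2`. Then the number `M` of modular points of
`A` is `2` if `k < m-2`, `3` if `k = m-2 ≥ 2`, and `4` if `k = m-2 = 1`; moreover,
when `k = m-2`, `A` is projectively equivalent to `A(m-2,1,3)`. -/
theorem modular_count_of_combinatorics (A : Finset ProjLine) (m k : ℕ) (hm : 3 ≤ m)
    (h : IsHomogSS A m)
    (h2 : ∃ p q : ProjPoint, p ≠ q ∧ IsModular A p ∧ IsModular A q)
    (hk : k ≤ m - 2) (w : ℕ → ℂ) (hw : IsWTuple (m - 2) k w)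
    (hcomb : SameCombinatorics A (arrW (m - 2) k w)) :
    (k < m - 2 → {p : ProjPoint | IsModular A p}.ncard = 2) ∧
    (k = m - 2 → 2 ≤ k → {p : ProjPoint | IsModular A p}.ncard = 3) ∧
    (k = m - 2 → k = 1 → {p : ProjPoint | IsModular A p}.ncard = 4) ∧
    (k = m - 2 → ProjEquiv A (monomialArr m)) := by
  have hn : 0 < m - 2 := by omega
  obtain ⟨φ, Φ, e⟩ := exists_cIso hcomb
  have hmult : ∀ q, IsModular (arrW (m - 2) k w) q → mult (arrW (m - 2) k w) q = m := by
    intro q hq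
    obtain ⟨p, hp, rfl⟩ := e.points.surjOn hq.1
    rw [e.mult_eq hp]
    exact h.2 p ((e.modular_iff hp).1 hq)
  have PQ : ptP ≠ ptQ := by simp [ptP, ptQ, mkPoint_eq_iff]
  have PR : ptP ≠ ptR := by simp [ptP, ptR, mkPoint_eq_iff]
  have QR : ptQ ≠ ptR := by simp [ptQ, ptR, mkPoint_eq_iff]
  have PD : ptP ≠ ptD := by simp [ptP, ptD, mkPoint_eq_iff]
  have QD : ptQ ≠ ptD := by simp [ptQ, ptD, mkPoint_eq_iff]
  have RD : ptR ≠ ptD := by simp [ptR, ptD, mkPoint_eq_iff]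
  refine ⟨?_, ?_, ?_, ?_⟩
  · intro hlt
    rw [← e.ncard_eq]
    have hsub : {p | IsModular (arrW (m - 2) k w) p} ⊆ {ptP, ptQ} := by
      intro q hq
      have hqm := hmult q hq
      by_contra hc
      simp only [Set.mem_insert_iff, Set.mem_singleton_iff, not_or] at hc
      by_cases hR : q = ptR
      · have := mult_ptR_le (k := k) (w := w) hn
        rw [hR] at hqm
        omega
      · have := mult_le_three (k := k) (w := w) hn hc.1 hc.2 hR
        have h0 : m = 3 := by omega
        have hk0 : k = 0 := by omega
        have := this.2 hk0
        omega
    apply le_antisymm (ncard_le_two _ _ hsub)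
    obtain ⟨p, q, hpq, hp, hq⟩ := h2
    have hfin : {p | IsModular (arrW (m - 2) k w) p}.Finite := (Set.toFinite _).subset hsub
    exact (Set.one_lt_ncard hfin).2 ⟨Φ p, (e.modular_iff hp.1).2 hp, Φ q,
      (e.modular_iff hq.1).2 hq, fun hc => hpq (e.points.injOn hp.1 hq.1 hc)⟩
  · intro hkm hk2
    subst hkm
    rw [← e.ncard_eq]
    have heq : {p | IsModular (arrW (m - 2) (m - 2) w) p} = {ptP, ptQ, ptR} := by
      ext q
      constructor
      · intro hq
        have hqm := hmult q hq
        by_contra hc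
        simp only [Set.mem_insert_iff, Set.mem_singleton_iff, not_or] at hc
        have := mult_le_three (k := m - 2) (w := w) hn hc.1 hc.2.1 hc.2.2
        omega
      · rintro (rfl | rfl | rfl)
        · exact ptP_modular hn hw
        · exact ptQ_modular hn hw
        · exact ptR_modular hn hw
    rw [heq, Set.ncard_eq_three]
    exact ⟨ptP, ptQ, ptR, PQ, PR, QR, rfl⟩
  · intro hkm hk1
    have hm3 : m = 3 := by omega
    subst hk1 hm3
    rw [← e.ncard_eq]
    have heq : {p | IsModular (arrW (3 - 2) 1 w) p} = {ptP, ptQ, ptR, ptD} := by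
      ext q
      constructor
      · intro hq
        have hqm := hmult q hq
        by_contra hc
        simp only [Set.mem_insert_iff, Set.mem_singleton_iff, not_or] at hc
        exact hc.2.2.2 (eq_ptD hw hc.1 hc.2.1 hc.2.2.1 hqm)
      · rintro (rfl | rfl | rfl | rfl)
        · exact ptP_modular hn hw
        · exact ptQ_modular hn hw
        · exact ptR_modular hn hw
        · exact ptD_modular hw
    rw [heq, Set.ncard_insert_of_notMem (by simp [PQ, PR, PD]), Set.ncard_eq_three.2
      ⟨ptQ, ptR, ptD, QR, QD, RD, rfl⟩]
  · intro hkm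
    subst hkm
    obtain ⟨p, hp, eP⟩ := e.points.surjOn (ptP_modular hn hw).1
    obtain ⟨q, hq, eQ⟩ := e.points.surjOn (ptQ_modular hn hw).1
    obtain ⟨r, hr, eR⟩ := e.points.surjOn (ptR_modular hn hw).1
    have mp : IsModular A p := (e.modular_iff hp).1 (eP ▸ ptP_modular hn hw)
    have mq : IsModular A q := (e.modular_iff hq).1 (eQ ▸ ptQ_modular hn hw)
    have mr : IsModular A r := (e.modular_iff hr).1 (eR ▸ ptR_modular hn hw)
    have hpq : p ≠ q := by
      rintro rfl
      exact PQ (eP.symm.trans eQ)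
    have hpr : p ≠ r := by
      rintro rfl
      exact PR (eP.symm.trans eR)
    have hqr : q ≠ r := by
      rintro rfl
      exact QR (eQ.symm.trans eR)
    refine projEquiv_of_three hm mp mq mr (h.2 p mp) (h.2 q mq) hpq hpr hqr ?_ ?_
    · rintro ⟨L, h1, h2, h3⟩
      obtain ⟨M, hM, g1, g2⟩ := mp.2 q hq hpq.symm
      have : L = M := (eq_or_eq' h1 h2 g1 g2).resolve_left hpq
      subst this
      have i1 := (e.inc p hp L hM).1 h1
      have i2 := (e.inc q hq L hM).1 h2
      have i3 := (e.inc r hr L hM).1 h3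
      rw [eP] at i1
      rw [eQ] at i2
      rw [eR] at i3
      obtain ⟨a, b, c, g, hL⟩ := exists_mkLine (φ L)
      rw [hL] at i1 i2 i3
      simp [ptP, ptQ, ptR, pointOnLine_coord] at i1 i2 i3
      tauto
    · have hle := Finset.card_le_card (arrW_subset_monomial hm hw)
      refine le_trans (le_of_eq ?_) hle
      have := e.lines.image_eq
      rw [← Set.ncard_coe_finset, ← Set.ncard_coe_finset, ← this]
      exact (Set.InjOn.ncard_image e.lines.injOn).symm

end
end

section
/- Let A be an m-homogeneous supersolvable line arrangement in ℙ² with m ≥ 3, and let p and p' be two distinct modular points of A. Then all the lines of A passing through neither p nor p' have a common intersection point; moreover their number k satisfies 0 ≤ k ≤ m−2, so that |A| = 2m−1+k ≤ 3m−3. -/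
open scoped LinearAlgebra.Projectivization

noncomputable section

attribute [local instance] Classical.propDecidable

lemma pol_mk (u : Fin 3 → ℂ) (hu : u ≠ 0) (L : ProjLine) :
    PointOnLine (Projectivization.mk ℂ u hu) L ↔ L.rep u = 0 := by
  unfold PointOnLine
  obtain ⟨a, ha⟩ := Projectivization.exists_smul_eq_mk_rep ℂ u hu
  rw [← ha, Units.smul_def, map_smul, smul_eq_mul]
  simp

lemma line_eq (L L' : ProjLine) (c : ℂ) (h : L.rep = c • L'.rep) : L = L' := by
  rw [← Projectivization.mk_rep L, ← Projectivization.mk_rep L',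
    Projectivization.mk_eq_mk_iff']
  exact ⟨c, h.symm⟩

lemma mult_eq (A : Finset ProjLine) (p : ProjPoint) :
    mult A p = (A.filter (fun L => PointOnLine p L)).card := by
  unfold mult
  rw [← Set.ncard_coe_finset]
  congr 1
  ext L
  simp

lemma inter_of_two (A : Finset ProjLine) (p : ProjPoint) (L L' : ProjLine) (hL : L ∈ A)
    (hL' : L' ∈ A) (hne : L ≠ L') (h : PointOnLine p L) (h' : PointOnLine p L') :
    IsIntersectionPoint A p := by
  unfold IsIntersectionPoint
  rw [mult_eq]
  exact Finset.one_lt_card.2 ⟨L, by simp [*], L', by simp [*], hne⟩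

/-- lines through two vectors plus a transversal: span lemma -/
lemma exists_frame_s6 (p p' : ProjPoint) (hpp' : p ≠ p') (M : ProjLine)
    (h : PointOnLine p M) (h' : PointOnLine p' M) :
    ∃ w : Fin 3 → ℂ, M.rep w ≠ 0 ∧
      ∀ f g : Module.Dual ℂ (Fin 3 → ℂ), f p.rep = g p.rep → f p'.rep = g p'.rep →
        f w = g w → f = g := by
  obtain ⟨w, hw⟩ : ∃ w, M.rep w ≠ 0 := by
    by_contra! hc
    exact M.rep_nonzero (LinearMap.ext hc)
  refine ⟨w, hw, ?_⟩
  have hli : LinearIndependent ℂ ![p.rep, p'.rep] := by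
    rw [LinearIndependent.pair_iff' p.rep_nonzero]
    intro a ha
    apply hpp'
    rw [← Projectivization.mk_rep p, ← Projectivization.mk_rep p', eq_comm,
      Projectivization.mk_eq_mk_iff']
    exact ⟨a, ha⟩
  have hli3 : LinearIndependent ℂ ![w, p.rep, p'.rep] := by
    refine linearIndependent_finCons.2 ⟨hli, fun hmem => hw ?_⟩
    have : Submodule.span ℂ (Set.range ![p.rep, p'.rep]) ≤ LinearMap.ker M.rep := by
      rw [Submodule.span_le]
      rintro _ ⟨i, rfl⟩
      fin_cases i
      · exact h
      · exact h'
    exact this hmem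
  intro f g h1 h2 h3
  let b := basisOfLinearIndependentOfCardEqFinrank hli3 (by simp)
  apply b.ext
  intro i
  fin_cases i <;> simp [b, h1, h2, h3]

/-- Modularity, in affine coordinates. -/
lemma modular_coord (A : Finset ProjLine) (p p' : ProjPoint) (M : ProjLine)
    (h : PointOnLine p M) (h' : PointOnLine p' M) (w : Fin 3 → ℂ) (hw : M.rep w ≠ 0)
    (hspan : ∀ f g : Module.Dual ℂ (Fin 3 → ℂ), f p.rep = g p.rep → f p'.rep = g p'.rep →
        f w = g w → f = g)
    (hp : IsModular A p) (x y : ℂ) (L L' : ProjLine) (hL : L ∈ A) (hL' : L' ∈ A)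
    (hne : L ≠ L') (hx : L.rep w + x * L.rep p.rep + y * L.rep p'.rep = 0)
    (hx' : L'.rep w + x * L'.rep p.rep + y * L'.rep p'.rep = 0) :
    ∃ N ∈ A, PointOnLine p N ∧ ¬ PointOnLine p' N ∧ N.rep w + y * N.rep p'.rep = 0 := by
  have hev : ∀ f : Module.Dual ℂ (Fin 3 → ℂ), f (w + x • p.rep + y • p'.rep)
      = f w + x * f p.rep + y * f p'.rep := by intro f; simp
  have hMq : M.rep (w + x • p.rep + y • p'.rep) ≠ 0 := by
    unfold PointOnLine at h h'
    rw [hev, h, h']; simpa using hw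
  have hu : w + x • p.rep + y • p'.rep ≠ 0 := by
    intro h0; rw [h0] at hMq; simp at hMq
  have hint : IsIntersectionPoint A (Projectivization.mk ℂ _ hu) :=
    inter_of_two A _ L L' hL hL' hne (by rw [pol_mk, hev]; exact hx)
      (by rw [pol_mk, hev]; exact hx')
  have hqp : Projectivization.mk ℂ _ hu ≠ p := by
    intro heq
    rw [← heq, pol_mk] at h
    exact hMq h
  obtain ⟨N, hN, hpN, hqN⟩ := hp.2 _ hint hqp
  rw [pol_mk, hev] at hqN
  have hpN0 : N.rep p.rep = 0 := hpN
  rw [hpN0, mul_zero, add_zero] at hqN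
  refine ⟨N, hN, hpN, fun hp'N => ?_, hqN⟩
  have hp'N0 : N.rep p'.rep = 0 := hp'N
  rw [hp'N0, mul_zero, add_zero] at hqN
  exact N.rep_nonzero (hspan _ 0 (by simpa using hpN0) (by simpa using hp'N0) (by simpa using hqN))

/-- Coordinates of the lines through `p` other than `M`. -/
lemma coords (A : Finset ProjLine) (m : ℕ) (p p' : ProjPoint) (M : ProjLine) (hM : M ∈ A)
    (h : PointOnLine p M) (h' : PointOnLine p' M) (w : Fin 3 → ℂ) (hw : M.rep w ≠ 0)
    (hspan : ∀ f g : Module.Dual ℂ (Fin 3 → ℂ), f p.rep = g p.rep → f p'.rep = g p'.rep →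
        f w = g w → f = g)
    (hmult : mult A p = m) :
    (A.filter (fun L => PointOnLine p L ∧ ¬ PointOnLine p' L)).card + 1 = m ∧
    ∃ Y : Finset ℂ, Y.card + 1 = m ∧ ∀ y, y ∈ Y ↔
      ∃ N ∈ A, PointOnLine p N ∧ ¬ PointOnLine p' N ∧ N.rep w + y * N.rep p'.rep = 0 := by
  have hc : (A.filter (fun L => PointOnLine p L ∧ ¬ PointOnLine p' L)).card + 1 = m := by
    rw [← hmult, mult_eq, ← Finset.card_insert_of_notMem (a := M) (by simp [h'])]
    congr 1
    ext L
    simp only [Finset.mem_insert, Finset.mem_filter]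
    constructor
    · rintro (rfl | hL)
      · exact ⟨hM, h⟩
      · exact ⟨hL.1, hL.2.1⟩
    · rintro ⟨hL, hpL⟩
      by_cases hp'L : PointOnLine p' L
      · left
        apply line_eq _ _ (L.rep w / M.rep w)
        unfold PointOnLine at *
        apply hspan
        · simp [h, hpL]
        · simp [h', hp'L]
        · simp [hw]
      · exact Or.inr ⟨hL, hpL, hp'L⟩
  refine ⟨hc, (A.filter (fun L => PointOnLine p L ∧ ¬ PointOnLine p' L)).image
    (fun L => - L.rep w / L.rep p'.rep), ?_, ?_⟩
  · rw [Finset.card_image_of_injOn, hc]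
    intro L hL L' hL' heq
    rw [Finset.mem_coe, Finset.mem_filter] at hL hL'
    simp only [PointOnLine] at hL hL' heq
    obtain ⟨_, h1, h2⟩ := hL
    obtain ⟨_, h3, h4⟩ := hL'
    apply line_eq _ _ (L.rep p'.rep / L'.rep p'.rep)
    rw [div_eq_div_iff h2 h4] at heq
    apply hspan
    · simp [h1, h3]
    · simp [h4]
    · simp only [LinearMap.smul_apply, smul_eq_mul]
      field_simp
      linear_combination -heq
  · intro y
    simp only [Finset.mem_image, Finset.mem_filter]
    constructor
    · rintro ⟨N, ⟨hN, h1, h2⟩, rfl⟩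
      have h2' : N.rep p'.rep ≠ 0 := h2
      exact ⟨N, hN, h1, h2, by field_simp; ring⟩
    · rintro ⟨N, hN, h1, h2, h3⟩
      have h2' : N.rep p'.rep ≠ 0 := h2
      exact ⟨N, ⟨hN, h1, h2⟩, by field_simp; linear_combination -h3⟩

/-- If `A` is an `m`-homogeneous supersolvable line arrangement
(`m ≥ 3`) and `p ≠ p'` are two modular points of `A`, then all lines of `A` passing
through neither `p` nor `p'` have a common point, their number `k` satisfies
`0 ≤ k ≤ m-2`, and `|A| = 2m - 1 + k ≤ 3m - 3`. -/
theorem lines_avoiding_two_modular_points (A : Finset ProjLine) (m : ℕ) (hm : 3 ≤ m)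
    (h : IsHomogSS A m) (p p' : ProjPoint) (hpp' : p ≠ p')
    (hp : IsModular A p) (hp' : IsModular A p') :
    (∃ q : ProjPoint, ∀ L ∈ A.filter (fun L => ¬ PointOnLine p L ∧ ¬ PointOnLine p' L),
      PointOnLine q L) ∧
    (A.filter (fun L => ¬ PointOnLine p L ∧ ¬ PointOnLine p' L)).card ≤ m - 2 ∧
    A.card = 2 * m - 1 +
      (A.filter (fun L => ¬ PointOnLine p L ∧ ¬ PointOnLine p' L)).card ∧
    A.card ≤ 3 * m - 3 := by
  obtain ⟨M, hM, hpM, hp'M⟩ := hp.2 p' hp'.1 hpp'.symm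
  obtain ⟨w, hw, hspan⟩ := exists_frame_s6 p p' hpp' M hpM hp'M
  have hspan' : ∀ f g : Module.Dual ℂ (Fin 3 → ℂ), f p'.rep = g p'.rep → f p.rep = g p.rep →
        f w = g w → f = g := fun f g a b c => hspan f g b a c
  obtain ⟨hc1, Y, hYc, hY⟩ := coords A m p p' M hM hpM hp'M w hw hspan (h.2 p hp)
  obtain ⟨hc2, X, hXc, hX⟩ := coords A m p' p M hM hp'M hpM w hw hspan' (h.2 p' hp')
  set K := A.filter (fun L => ¬ PointOnLine p L ∧ ¬ PointOnLine p' L) with hK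
  have hKm : ∀ N ∈ K, N ∈ A ∧ N.rep p.rep ≠ 0 ∧ N.rep p'.rep ≠ 0 := by
    intro N hN
    rw [hK, Finset.mem_filter] at hN
    exact ⟨hN.1, hN.2.1, hN.2.2⟩
  -- the projection from Y to X along a line
  have hmap : ∀ N ∈ K, ∀ y ∈ Y, - (N.rep w + y * N.rep p'.rep) / N.rep p.rep ∈ X := by
    intro N hN y hy
    obtain ⟨hNA, hN1, hN2⟩ := hKm N hN
    obtain ⟨L, hL, hL1, hL2, hL3⟩ := (hY y).1 hy
    rw [hX]
    have hL1' : L.rep p.rep = 0 := hL1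
    refine modular_coord A p' p M hp'M hpM w hw hspan' hp' y _ L N hL hNA ?_ ?_ ?_
    · rintro rfl; exact hN1 hL1
    · rw [hL1']; linear_combination hL3
    · field_simp; ring
  have hXY : X.card = Y.card := by omega
  have hn0 : (Y.card : ℂ) ≠ 0 := by
    have : Y.card ≠ 0 := by omega
    exact_mod_cast this
  set x0 : ℂ := (∑ x ∈ X, x) / Y.card with hx0
  set y0 : ℂ := (∑ y ∈ Y, y) / Y.card with hy0
  have hcent : ∀ N ∈ K, N.rep w + x0 * N.rep p.rep + y0 * N.rep p'.rep = 0 := by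
    intro N hN
    obtain ⟨hNA, hN1, hN2⟩ := hKm N hN
    have hinj : Set.InjOn (fun y => - (N.rep w + y * N.rep p'.rep) / N.rep p.rep) Y := by
      intro y _ y' _ heq
      simp only at heq
      rw [div_left_inj' hN1] at heq
      apply mul_right_cancel₀ hN2
      linear_combination -heq
    have himg : Y.image (fun y => - (N.rep w + y * N.rep p'.rep) / N.rep p.rep) = X := by
      apply Finset.eq_of_subset_of_card_le
      · intro x hx
        obtain ⟨y, hy, rfl⟩ := Finset.mem_image.1 hx
        exact hmap N hN y hy
      · rw [Finset.card_image_of_injOn hinj, hXY]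
    have hsum : ∑ x ∈ X, x = - (Y.card * N.rep w + (∑ y ∈ Y, y) * N.rep p'.rep) / N.rep p.rep := by
      rw [← himg, Finset.sum_image hinj, ← Finset.sum_div, Finset.sum_neg_distrib,
        Finset.sum_add_distrib, Finset.sum_const, ← Finset.sum_mul, nsmul_eq_mul]
    rw [hx0, hy0, hsum]
    field_simp
    ring
  have hu : w + x0 • p.rep + y0 • p'.rep ≠ 0 := by
    intro h0
    apply hw
    have h1 : M.rep p.rep = 0 := hpM
    have h2 : M.rep p'.rep = 0 := hp'M
    have := congrArg M.rep h0
    simpa [h1, h2] using this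
  have hbound : K.card ≤ m - 2 := by
    rcases Nat.lt_or_ge 1 K.card with hk | hk
    · obtain ⟨N, hN, N', hN', hne⟩ := Finset.one_lt_card.1 hk
      have hy0Y : y0 ∈ Y := by
        rw [hY]
        exact modular_coord A p p' M hpM hp'M w hw hspan hp x0 y0 N N' (hKm N hN).1
          (hKm N' hN').1 hne (hcent N hN) (hcent N' hN')
      have hx0X : x0 ∈ X := by
        rw [hX]
        exact modular_coord A p' p M hp'M hpM w hw hspan' hp' y0 x0 N N' (hKm N hN).1
          (hKm N' hN').1 hne (by linear_combination hcent N hN)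
          (by linear_combination hcent N' hN')
      obtain ⟨y1, hy1, hy10⟩ := Finset.exists_mem_ne (s := Y) (by omega) y0
      have hd : y1 - y0 ≠ 0 := sub_ne_zero.2 hy10
      have : K.card ≤ (X.erase x0).card := by
        apply Finset.card_le_card_of_injOn
          (fun N => - (N.rep w + y1 * N.rep p'.rep) / N.rep p.rep)
        · intro N hN
          obtain ⟨hNA, hN1, hN2⟩ := hKm N hN
          simp only [Finset.coe_erase, Set.mem_sdiff, Set.mem_singleton_iff]
          refine ⟨hmap N hN y1 hy1, fun heq => ?_⟩
          rw [div_eq_iff hN1] at heq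
          apply mul_ne_zero hd hN2
          linear_combination -heq - hcent N hN
        · intro N hN N' hN' heq
          obtain ⟨hNA, hN1, hN2⟩ := hKm N hN
          obtain ⟨hNA', hN1', hN2'⟩ := hKm N' hN'
          have e1 := hcent N hN
          have e2 := hcent N' hN'
          simp only at heq
          rw [div_eq_div_iff hN1 hN1'] at heq
          have hpr : N.rep p'.rep * N'.rep p.rep = N'.rep p'.rep * N.rep p.rep := by
            apply mul_left_cancel₀ hd
            linear_combination -heq - N'.rep p.rep * e1 + N.rep p.rep * e2
          apply line_eq _ _ (N.rep p.rep / N'.rep p.rep)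
          apply hspan
          · simp [hN1']
          · simp only [LinearMap.smul_apply, smul_eq_mul]
            field_simp
            linear_combination hpr
          · simp only [LinearMap.smul_apply, smul_eq_mul]
            field_simp
            linear_combination N'.rep p.rep * e1 - N.rep p.rep * e2 - y0 * hpr
      rw [Finset.card_erase_of_mem hx0X] at this
      omega
    · omega
  have hcard : A.card = 2 * m - 1 + K.card := by
    have e1 := Finset.card_filter_add_card_filter_not (s := A) (fun L => PointOnLine p L)
    have e2 := Finset.card_filter_add_card_filter_not
      (s := A.filter (fun L => ¬ PointOnLine p L)) (fun L => PointOnLine p' L)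
    rw [Finset.filter_filter, Finset.filter_filter] at e2
    have e3 := h.2 p hp
    rw [mult_eq] at e3
    have e4 : (A.filter (fun L => ¬ PointOnLine p L ∧ PointOnLine p' L)).card + 1 = m := by
      rw [← hc2]
      congr 2
      ext L
      simp only [Finset.mem_filter]
      tauto
    rw [← hK] at e2
    omega
  refine ⟨⟨Projectivization.mk ℂ _ hu, fun N hN => ?_⟩, hbound, hcard, by omega⟩
  rw [pol_mk]
  simpa using hcent N hN

end
end

section
/- Let A' be a generic arrangement of d' ≥ 3 lines in ℙ², let p be any point not lying on a line of A', and let A = C(A',p)_e be the cone over A' with vertex p, for any e ≥ 0. Then, with d = |A|, the number of double points of A satisfies n₂ ≥ d/2. -/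
open scoped LinearAlgebra.Projectivization

noncomputable section

attribute [local instance] Classical.propDecidable

/-- A generic line arrangement: all intersection points are double points. -/
def IsGeneric (A : Finset ProjLine) : Prop :=
  ∀ p, IsIntersectionPoint A p → mult A p = 2

/-- `A` is the cone `C(A',p)_e` over `A'` with vertex `p`: the point `p` lies on no
line of `A'`, and `A` consists of the lines of `A'`, all the lines joining `p` to the
intersection points of `A'`, and `e` further distinct lines through `p`, each meeting
the lines of `A'` only in points lying on exactly one line of `A'`. -/
def IsConeOf (A' : Finset ProjLine) (p : ProjPoint) (e : ℕ) (A : Finset ProjLine) : Prop :=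
  (∀ L ∈ A', ¬ PointOnLine p L) ∧
  ∃ E : Finset ProjLine, E.card = e ∧
    (∀ L ∈ E, PointOnLine p L ∧ ∀ q : ProjPoint, PointOnLine q L → mult A' q ≤ 1) ∧
    ∀ L : ProjLine, L ∈ A ↔ (L ∈ A' ∨ L ∈ E ∨
      (PointOnLine p L ∧ ∃ q : ProjPoint, IsIntersectionPoint A' q ∧ PointOnLine q L))

/-! ### Algebraic part -/

/-- A linear form as a polynomial. -/
def formPoly : Module.Dual ℂ (Fin 3 → ℂ) →ₗ[ℂ] MvPolynomial (Fin 3) ℂ where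
  toFun f := ∑ k, MvPolynomial.C (f (Pi.single k 1)) * MvPolynomial.X k
  map_add' f g := by simp [add_mul, Finset.sum_add_distrib]
  map_smul' c f := by
    simp [MvPolynomial.smul_eq_C_mul, Finset.mul_sum, mul_assoc]

lemma eval_formPoly (f : Module.Dual ℂ (Fin 3 → ℂ)) (w : Fin 3 → ℂ) :
    MvPolynomial.eval w (formPoly f) = f w := by
  have h := LinearMap.pi_apply_eq_sum_univ f w
  rw [h]
  simp only [formPoly, LinearMap.coe_mk, AddHom.coe_mk, map_sum, map_mul, MvPolynomial.eval_C,
    MvPolynomial.eval_X, smul_eq_mul]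
  refine Finset.sum_congr rfl fun k _ => ?_
  rw [mul_comm]
  congr 2
  ext j
  simp [Pi.single_apply, eq_comm]

lemma formPoly_injective : Function.Injective formPoly := by
  intro f g h
  ext1 w
  ext
  simp [← eval_formPoly, h]

lemma lagrange_vanish {ι : Type*} [DecidableEq ι] (s : Finset ι) (hn : 3 ≤ s.card)
    (lam : ι → Module.Dual ℂ (Fin 3 → ℂ)) (hinj : Set.InjOn lam s)
    (D : MvPolynomial (Fin 3) ℂ) (c : ι → ℂ) (hc : ∀ i ∈ s, c i ≠ 0)
    (h : ∀ i ∈ s, ∏ j ∈ s.erase i, (formPoly (lam i) - formPoly (lam j))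
      = MvPolynomial.C (c i) * D) (w : Fin 3 → ℂ) :
    ∑ i ∈ s, (c i)⁻¹ * (lam i w) ^ (s.card - 2) = 0 := by
  let K := FractionRing (MvPolynomial (Fin 3) ℂ)
  let φ : MvPolynomial (Fin 3) ℂ →+* K := algebraMap _ _
  have hφ : Function.Injective φ := IsFractionRing.injective _ _
  let v : ι → K := fun i => φ (formPoly (lam i))
  have hv : Set.InjOn v s := fun i hi j hj hij => hinj hi hj (formPoly_injective (hφ hij))
  have hL := Lagrange.coeff_eq_sum (s := s) (v := v) hv
    (P := (Polynomial.X : Polynomial K) ^ (s.card - 2)) (by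
      rw [Polynomial.degree_X_pow]; norm_cast; omega)
  rw [Polynomial.coeff_X_pow, if_neg (by omega)] at hL
  have hprod : ∀ i ∈ s, ∏ j ∈ s.erase i, (v i - v j) = φ (MvPolynomial.C (c i)) * φ D := by
    intro i hi
    rw [← map_mul, ← h i hi, map_prod]
    simp [v]
  obtain ⟨i0, hi0⟩ : s.Nonempty := Finset.card_pos.1 (by omega)
  have hD : φ D ≠ 0 := by
    intro h0
    have h1 := hprod i0 hi0
    rw [h0, mul_zero, Finset.prod_eq_zero_iff] at h1
    obtain ⟨j, hj, hj2⟩ := h1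
    rw [Finset.mem_erase] at hj
    exact hj.1 (hv hj.2 hi0 (sub_eq_zero.1 hj2).symm)
  have hsum : φ (∑ i ∈ s, MvPolynomial.C (c i)⁻¹ * formPoly (lam i) ^ (s.card - 2)) = 0 := by
    have h2 : φ (∑ i ∈ s, MvPolynomial.C (c i)⁻¹ * formPoly (lam i) ^ (s.card - 2))
        = φ D * ∑ i ∈ s, ((Polynomial.X : Polynomial K) ^ (s.card - 2)).eval (v i) /
          ∏ j ∈ s.erase i, (v i - v j) := by
      rw [map_sum, Finset.mul_sum]
      refine Finset.sum_congr rfl fun i hi => ?_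
      rw [hprod i hi, Polynomial.eval_pow, Polynomial.eval_X, map_mul, map_pow]
      have h3 : φ (MvPolynomial.C (c i)⁻¹) * φ (MvPolynomial.C (c i)) = 1 := by
        rw [← map_mul, ← map_mul, inv_mul_cancel₀ (hc i hi), map_one, map_one]
      have h4 : φ (MvPolynomial.C (c i)) ≠ 0 := right_ne_zero_of_mul_eq_one h3
      rw [← mul_div_assoc, eq_div_iff (mul_ne_zero h4 hD)]
      linear_combination (φ (formPoly (lam i)) ^ (s.card - 2) * φ D) * h3
    rw [h2, ← hL, mul_zero]
  have h5 := hφ (hsum.trans (map_zero φ).symm)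
  have h6 := congrArg (MvPolynomial.eval w) h5
  simpa [eval_formPoly] using h6

lemma polar_step {ι : Type*} (s : Finset ι) (lam : ι → Module.Dual ℂ (Fin 3 → ℂ))
    (γ : ι → ℂ) (k : ℕ) (H : ∀ w, ∑ i ∈ s, γ i * (lam i w) ^ (k + 1) = 0)
    (v w : Fin 3 → ℂ) : ∑ i ∈ s, (γ i * lam i v) * (lam i w) ^ k = 0 := by
  let P : Polynomial ℂ := ∑ i ∈ s, Polynomial.C (γ i) *
    (Polynomial.C (lam i w) + Polynomial.C (lam i v) * Polynomial.X) ^ (k + 1)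
  have hP : P = 0 := by
    apply Polynomial.funext
    intro t
    have := H (w + t • v)
    simp only [P, Polynomial.eval_finsetSum, Polynomial.eval_mul, Polynomial.eval_pow,
      Polynomial.eval_add, Polynomial.eval_C, Polynomial.eval_X, Polynomial.eval_zero]
    rw [← this]
    refine Finset.sum_congr rfl fun i _ => ?_
    rw [map_add, map_smul, smul_eq_mul, mul_comm t]
  have h2 := congrArg (fun q => Polynomial.eval 0 (Polynomial.derivative q)) hP
  simp only [P, Polynomial.derivative_sum, Polynomial.eval_finsetSum] at h2
  simp [Polynomial.derivative_pow] at h2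
  have h3 : ((k : ℂ) + 1) * ∑ i ∈ s, (γ i * lam i v) * (lam i w) ^ k = 0 := by
    rw [← h2, Finset.mul_sum]
    exact Finset.sum_congr rfl fun i _ => by ring
  exact (mul_eq_zero.1 h3).resolve_left (by exact_mod_cast Nat.succ_ne_zero k)

lemma polar {ι κ : Type*} [DecidableEq κ] (s : Finset ι)
    (lam : ι → Module.Dual ℂ (Fin 3 → ℂ)) (v : κ → Fin 3 → ℂ) (t : Finset κ) :
    ∀ γ : ι → ℂ, (∀ w, ∑ i ∈ s, γ i * (lam i w) ^ t.card = 0) →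
      ∑ i ∈ s, γ i * ∏ x ∈ t, lam i (v x) = 0 := by
  induction t using Finset.induction_on with
  | empty => intro γ H; simpa using H 0
  | insert a t ha ih =>
    intro γ H
    rw [Finset.card_insert_of_notMem ha] at H
    have := ih (fun i => γ i * lam i (v a)) (fun w => polar_step s lam γ _ H (v a) w)
    rw [← this]
    refine Finset.sum_congr rfl fun i _ => ?_
    rw [Finset.prod_insert ha, mul_assoc]

lemma exists_common_zero (f g : Module.Dual ℂ (Fin 3 → ℂ)) :
    ∃ w : Fin 3 → ℂ, w ≠ 0 ∧ f w = 0 ∧ g w = 0 := by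
  have h := LinearMap.ker_ne_bot_of_finrank_lt (f := f.prod g) (by simp)
  obtain ⟨w, hw, hw0⟩ := Submodule.exists_mem_ne_zero_of_ne_bot h
  rw [LinearMap.mem_ker] at hw
  exact ⟨w, hw0, congrArg Prod.fst hw, congrArg Prod.snd hw⟩

lemma alg_contra {ι : Type*} [DecidableEq ι] (s : Finset ι) (hn : 3 ≤ s.card)
    (lam : ι → Module.Dual ℂ (Fin 3 → ℂ)) (γ : ι → ℂ) (hγ : ∀ i ∈ s, γ i ≠ 0)
    (H : ∀ w, ∑ i ∈ s, γ i * (lam i w) ^ (s.card - 2) = 0)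
    (hgen : ∀ i ∈ s, ∀ j ∈ s, ∀ k ∈ s, i ≠ j → i ≠ k → j ≠ k → ∀ w, lam i w = 0 →
      lam j w = 0 → lam k w = 0 → w = 0) : False := by
  obtain ⟨i, hi, b, hb, hib⟩ := Finset.one_lt_card.1 (show 1 < s.card by omega)
  choose v hv0 hv1 hv2 using fun x => exists_common_zero (lam x) (lam b)
  let t := (s.erase i).erase b
  have hbi : b ∈ s.erase i := Finset.mem_erase.2 ⟨hib.symm, hb⟩
  have ht : t.card = s.card - 2 := by
    rw [Finset.card_erase_of_mem hbi, Finset.card_erase_of_mem hi]; omega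
  have hP := polar s lam v t γ (by rw [ht]; exact H)
  rw [Finset.sum_eq_single_of_mem i hi] at hP
  · rcases mul_eq_zero.1 hP with h | h
    · exact hγ i hi h
    · obtain ⟨x, hx, hx0⟩ := Finset.prod_eq_zero_iff.1 h
      simp only [t, Finset.mem_erase] at hx
      exact hv0 x (hgen i hi x hx.2.2 b hb (Ne.symm hx.2.1) hib hx.1 _ hx0 (hv1 x) (hv2 x))
  · intro j hj hji
    apply mul_eq_zero_of_right
    by_cases hjb : j = b
    · obtain ⟨a, ha⟩ : t.Nonempty := Finset.card_pos.1 (by omega)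
      exact Finset.prod_eq_zero ha (by rw [hjb]; exact hv2 a)
    · exact Finset.prod_eq_zero (i := j) (by simp [t, hjb, hji, hj]) (hv1 j)

/-! ### Incidence geometry -/

lemma on_mk_point (w : Fin 3 → ℂ) (hw : w ≠ 0) (L : ProjLine) :
    PointOnLine (Projectivization.mk ℂ w hw) L ↔ L.rep w = 0 := by
  obtain ⟨a, ha⟩ := Projectivization.exists_smul_eq_mk_rep ℂ w hw
  unfold PointOnLine
  rw [← ha, Units.smul_def, map_smul, smul_eq_mul]
  simp

lemma on_mk_line (p : ProjPoint) (f : Module.Dual ℂ (Fin 3 → ℂ)) (hf : f ≠ 0) :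
    PointOnLine p (Projectivization.mk ℂ f hf) ↔ f p.rep = 0 := by
  obtain ⟨a, ha⟩ := Projectivization.exists_smul_eq_mk_rep ℂ f hf
  unfold PointOnLine
  rw [← ha, Units.smul_def, LinearMap.smul_apply, smul_eq_mul]
  simp

lemma exists_meet (L L' : ProjLine) : ∃ q, PointOnLine q L ∧ PointOnLine q L' := by
  obtain ⟨w, hw, h1, h2⟩ := exists_common_zero L.rep L'.rep
  exact ⟨Projectivization.mk ℂ w hw, (on_mk_point _ _ _).2 h1, (on_mk_point _ _ _).2 h2⟩

lemma line_unique {q q' : ProjPoint} (hq : q ≠ q') {L L' : ProjLine}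
    (h1 : PointOnLine q L) (h2 : PointOnLine q' L) (h3 : PointOnLine q L')
    (h4 : PointOnLine q' L') : L = L' := by
  by_contra hne
  have hi := Projectivization.linearIndependent_pair_iff_ne.2 hq
  have hi' := Projectivization.linearIndependent_pair_iff_ne.2 hne
  let W : Submodule ℂ (Fin 3 → ℂ) := Submodule.span ℂ (Set.range ![q.rep, q'.rep])
  have hW : Module.finrank ℂ W = 2 := by
    simpa using finrank_span_eq_card hi
  have hA := Subspace.finrank_add_finrank_dualAnnihilator_eq W
  have hle : Submodule.span ℂ (Set.range ![L.rep, L'.rep]) ≤ W.dualAnnihilator := by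
    rw [Submodule.span_le]
    rintro _ ⟨k, rfl⟩
    rw [SetLike.mem_coe, Submodule.mem_dualAnnihilator]
    intro w hw
    refine Submodule.span_induction (p := fun w _ => ![L.rep, L'.rep] k w = 0)
      ?_ (by simp) ?_ ?_ hw
    · rintro _ ⟨l, rfl⟩
      fin_cases k <;> fin_cases l <;> simpa [PointOnLine] using by assumption
    · intro x y _ _ hx hy; rw [map_add, hx, hy, add_zero]
    · intro a x _ hx; rw [map_smul, hx, smul_zero]
  have h5 := Submodule.finrank_mono hle
  have h6 : Module.finrank ℂ (Submodule.span ℂ (Set.range ![L.rep, L'.rep])) = 2 := by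
    simpa using finrank_span_eq_card hi'
  rw [Module.finrank_fin_fun] at hA
  omega

lemma mult_eq_card (A : Finset ProjLine) (q : ProjPoint) :
    mult A q = (A.filter (PointOnLine q)).card := by
  rw [mult, ← Set.ncard_coe_finset]
  congr 1
  ext L
  simp

lemma two_le_mult {A : Finset ProjLine} {q : ProjPoint} :
    IsIntersectionPoint A q ↔
      ∃ L ∈ A, ∃ L' ∈ A, L ≠ L' ∧ PointOnLine q L ∧ PointOnLine q L' := by
  unfold IsIntersectionPoint
  rw [mult_eq_card, ← Nat.lt_iff_add_one_le, Finset.one_lt_card]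
  constructor
  · rintro ⟨L, hL, L', hL', h⟩
    rw [Finset.mem_filter] at hL hL'
    exact ⟨L, hL.1, L', hL'.1, h, hL.2, hL'.2⟩
  · rintro ⟨L, hL, L', hL', h, h1, h2⟩
    exact ⟨L, Finset.mem_filter.2 ⟨hL, h1⟩, L', Finset.mem_filter.2 ⟨hL', h2⟩, h⟩

lemma finite_inter (A : Finset ProjLine) : {q | IsIntersectionPoint A q}.Finite := by
  choose X hX1 hX2 using exists_meet
  refine ((A ×ˢ A).image (fun z => X z.1 z.2)).finite_toSet.subset ?_
  intro q hq
  obtain ⟨L, hL, L', hL', hne, h1, h2⟩ := two_le_mult.1 hq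
  rw [Finset.mem_coe, Finset.mem_image]
  refine ⟨(L, L'), Finset.mem_product.2 ⟨hL, hL'⟩, ?_⟩
  by_contra h
  exact hne (line_unique h (hX1 L L') h1 (hX2 L L') h2)

lemma generic_three {A : Finset ProjLine} (hgen : IsGeneric A) {L1 L2 L3 : ProjLine}
    (h1 : L1 ∈ A) (h2 : L2 ∈ A) (h3 : L3 ∈ A) (h12 : L1 ≠ L2) (h13 : L1 ≠ L3) (h23 : L2 ≠ L3)
    {q : ProjPoint} (q1 : PointOnLine q L1) (q2 : PointOnLine q L2) (q3 : PointOnLine q L3) :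
    False := by
  have h := hgen q (two_le_mult.2 ⟨L1, h1, L2, h2, h12, q1, q2⟩)
  rw [mult_eq_card] at h
  have : 2 < (A.filter (PointOnLine q)).card :=
    Finset.two_lt_card.2 ⟨L1, by simp [h1, q1], L2, by simp [h2, q2], L3, by simp [h3, q3],
      h12, h13, h23⟩
  omega

/-- Normalised equation of a line not passing through `p`. -/
def nform (p : ProjPoint) (L : ProjLine) : Module.Dual ℂ (Fin 3 → ℂ) :=
  (L.rep p.rep)⁻¹ • L.rep

lemma nform_zero_iff {p : ProjPoint} {L : ProjLine} (h : ¬ PointOnLine p L) (w : Fin 3 → ℂ) :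
    nform p L w = 0 ↔ L.rep w = 0 := by
  have : L.rep p.rep ≠ 0 := h
  simp [nform, this]

lemma nform_p {p : ProjPoint} {L : ProjLine} (h : ¬ PointOnLine p L) :
    nform p L p.rep = 1 := by
  have : L.rep p.rep ≠ 0 := h
  simp [nform, this]

lemma nform_inj {p : ProjPoint} {L L' : ProjLine} (h : ¬ PointOnLine p L)
    (h' : ¬ PointOnLine p L') (he : nform p L = nform p L') : L = L' := by
  have h1 : (L.rep p.rep)⁻¹ ≠ 0 := inv_ne_zero h
  have h2 : (L'.rep p.rep)⁻¹ ≠ 0 := inv_ne_zero h'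
  rw [← L.mk_rep, ← L'.mk_rep, Projectivization.mk_eq_mk_iff']
  refine ⟨(L.rep p.rep) * (L'.rep p.rep)⁻¹, ?_⟩
  unfold nform at he
  rw [mul_smul, ← he, smul_smul, mul_inv_cancel₀ h, one_smul]

/-- The line joining `p` to the intersection of `L` and `L'`. -/
def joinLine (p : ProjPoint) (L L' : ProjLine) : ProjLine :=
  if h : nform p L - nform p L' ≠ 0 then Projectivization.mk ℂ _ h else L

section Cone

variable {A' A : Finset ProjLine} {p : ProjPoint}

lemma joinLine_eq (hp : ∀ L ∈ A', ¬ PointOnLine p L) {L L' : ProjLine} (hL : L ∈ A')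
    (hL' : L' ∈ A') (hne : L ≠ L') : ∃ h : nform p L - nform p L' ≠ 0,
    joinLine p L L' = Projectivization.mk ℂ _ h := by
  have h : nform p L - nform p L' ≠ 0 :=
    fun h => hne (nform_inj (hp L hL) (hp L' hL') (sub_eq_zero.1 h))
  exact ⟨h, dif_pos h⟩

lemma joinLine_p (hp : ∀ L ∈ A', ¬ PointOnLine p L) {L L' : ProjLine} (hL : L ∈ A')
    (hL' : L' ∈ A') (hne : L ≠ L') : PointOnLine p (joinLine p L L') := by
  obtain ⟨h, he⟩ := joinLine_eq hp hL hL' hne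
  rw [he, on_mk_line, LinearMap.sub_apply, nform_p (hp L hL), nform_p (hp L' hL'), sub_self]

lemma joinLine_on (hp : ∀ L ∈ A', ¬ PointOnLine p L) {L L' : ProjLine} (hL : L ∈ A')
    (hL' : L' ∈ A') (hne : L ≠ L') {q : ProjPoint} (hq : PointOnLine q L) :
    PointOnLine q (joinLine p L L') ↔ PointOnLine q L' := by
  obtain ⟨h, he⟩ := joinLine_eq hp hL hL' hne
  rw [he, on_mk_line, LinearMap.sub_apply, (nform_zero_iff (hp L hL) _).2 hq, zero_sub,
    neg_eq_zero, nform_zero_iff (hp L' hL')]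
  rfl

lemma joinLine_injOn (hp : ∀ L ∈ A', ¬ PointOnLine p L) (hgen : IsGeneric A')
    {L : ProjLine} (hL : L ∈ A') : Set.InjOn (joinLine p L) (A'.erase L) := by
  intro L1 h1 L2 h2 he
  rw [Finset.mem_coe, Finset.mem_erase] at h1 h2
  by_contra hne
  obtain ⟨q, hq, hq1⟩ := exists_meet L L1
  have hj := (joinLine_on hp hL h1.2 h1.1.symm hq).2 hq1
  rw [he] at hj
  have hq2 := (joinLine_on hp hL h2.2 h2.1.symm hq).1 hj
  exact generic_three hgen hL h1.2 h2.2 h1.1.symm h2.1.symm hne hq hq1 hq2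

/-- The key point: the pencil at `p` has at least `d'` lines. -/
lemma pencil_card (hd' : 3 ≤ A'.card) (hp : ∀ L ∈ A', ¬ PointOnLine p L) (hgen : IsGeneric A')
    (B : Finset ProjLine)
    (hB : ∀ L ∈ A', ∀ L' ∈ A', L ≠ L' → joinLine p L L' ∈ B) : A'.card ≤ B.card := by
  by_contra hlt
  have himg : ∀ L ∈ A', (A'.erase L).image (joinLine p L) = B := by
    intro L hL
    apply Finset.eq_of_subset_of_card_le
    · intro x hx
      obtain ⟨L', h', rfl⟩ := Finset.mem_image.1 hx
      rw [Finset.mem_erase] at h'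
      exact hB L hL L' h'.2 h'.1.symm
    · rw [Finset.card_image_of_injOn (joinLine_injOn hp hgen hL), Finset.card_erase_of_mem hL]
      omega
  have key : ∀ L ∈ A', ∃ c : ℂ, c ≠ 0 ∧
      ∏ L' ∈ A'.erase L, (formPoly (nform p L) - formPoly (nform p L'))
        = MvPolynomial.C c * ∏ b ∈ B, formPoly b.rep := by
    intro L hL
    have hu : ∀ L' ∈ A'.erase L, ∃ a : ℂ, a ≠ 0 ∧ formPoly (nform p L) - formPoly (nform p L')
        = MvPolynomial.C a * formPoly (joinLine p L L').rep := by
      intro L' h'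
      rw [Finset.mem_erase] at h'
      obtain ⟨h, he⟩ := joinLine_eq hp hL h'.2 h'.1.symm
      obtain ⟨a, ha⟩ := Projectivization.exists_smul_eq_mk_rep ℂ _ h
      refine ⟨(a : ℂ)⁻¹, inv_ne_zero a.ne_zero, ?_⟩
      rw [he, ← ha, Units.smul_def, map_smul, ← MvPolynomial.smul_eq_C_mul, smul_smul,
        inv_mul_cancel₀ a.ne_zero, one_smul, map_sub]
    choose! a ha0 ha using hu
    refine ⟨∏ L' ∈ A'.erase L, a L', Finset.prod_ne_zero_iff.2 ha0, ?_⟩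
    rw [Finset.prod_congr rfl ha, Finset.prod_mul_distrib, map_prod]
    congr 1
    rw [← himg L hL, Finset.prod_image (joinLine_injOn hp hgen hL)]
  choose! c hc0 hc using key
  have hv := lagrange_vanish A' hd' (nform p)
    (fun L hL L' hL' he => nform_inj (hp L hL) (hp L' hL') he) _ c hc0 hc
  refine alg_contra A' hd' (nform p) (fun L => (c L)⁻¹) (fun L hL => inv_ne_zero (hc0 L hL)) hv ?_
  intro i hi j hj k hk hij hik hjk w wi wj wk
  by_contra hw
  rw [nform_zero_iff (hp _ ‹_›)] at wi wj wk
  exact generic_three hgen hi hj hk hij hik hjk (q := Projectivization.mk ℂ w hw)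
    ((on_mk_point _ _ _).2 wi) ((on_mk_point _ _ _).2 wj) ((on_mk_point _ _ _).2 wk)

/-- Counting the double points. -/
lemma double_count (hp : ∀ L ∈ A', ¬ PointOnLine p L) (hgen : IsGeneric A')
    (B : Finset ProjLine) (hBp : ∀ L ∈ B, PointOnLine p L)
    (hA : ∀ L, L ∈ A ↔ L ∈ A' ∨ L ∈ B)
    (hB : ∀ L ∈ A', ∀ L' ∈ A', L ≠ L' → joinLine p L L' ∈ B) :
    A'.card * (B.card - (A'.card - 1)) ≤ nk A 2 := by
  choose X hX1 hX2 using exists_meet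
  let T : Finset (Σ _ : ProjLine, ProjLine) :=
    A'.sigma fun L => B \ (A'.erase L).image (joinLine p L)
  have hT : T.card = A'.card * (B.card - (A'.card - 1)) := by
    rw [Finset.card_sigma, Finset.sum_const_nat]
    intro L hL
    rw [Finset.card_sdiff_of_subset, Finset.card_image_of_injOn (joinLine_injOn hp hgen hL),
      Finset.card_erase_of_mem hL]
    intro x hx
    obtain ⟨L', h', rfl⟩ := Finset.mem_image.1 hx
    rw [Finset.mem_erase] at h'
    exact hB L hL L' h'.2 h'.1.symm
  have hset : ∀ z ∈ T, A.filter (PointOnLine (X z.1 z.2)) = {z.1, z.2} := by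
    rintro ⟨L, l⟩ hz
    simp only [T, Finset.mem_sigma, Finset.mem_sdiff] at hz
    obtain ⟨hL, hl, hnot⟩ := hz
    have hqp : p ≠ X L l := fun h => hp L hL (by rw [h]; exact hX1 L l)
    ext M
    simp only [Finset.mem_filter, Finset.mem_insert, Finset.mem_singleton]
    constructor
    · rintro ⟨hM, hq⟩
      rcases (hA M).1 hM with hM | hM
      · left
        by_contra hne
        apply hnot
        rw [Finset.mem_image]
        refine ⟨M, Finset.mem_erase.2 ⟨hne, hM⟩, ?_⟩
        exact line_unique hqp (joinLine_p hp hL hM (Ne.symm hne))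
          ((joinLine_on hp hL hM (Ne.symm hne) (hX1 L l)).2 hq) (hBp l hl) (hX2 L l)
      · right
        exact line_unique hqp (hBp M hM) hq (hBp l hl) (hX2 L l)
    · rintro (rfl | rfl)
      · exact ⟨(hA _).2 (Or.inl hL), hX1 _ _⟩
      · exact ⟨(hA _).2 (Or.inr hl), hX2 _ _⟩
  have hinj : Set.InjOn (fun z : (Σ _ : ProjLine, ProjLine) => X z.1 z.2) T := by
    intro z hz z' hz' he
    have h1 := hset z hz
    have h2 := hset z' hz'
    simp only at he
    rw [he, h2] at h1
    simp only [T, Finset.mem_coe, Finset.mem_sigma, Finset.mem_sdiff] at hz hz'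
    have a1 : z'.1 ∈ ({z.1, z.2} : Finset ProjLine) := by rw [← h1]; simp
    have a2 : z'.2 ∈ ({z.1, z.2} : Finset ProjLine) := by rw [← h1]; simp
    simp only [Finset.mem_insert, Finset.mem_singleton] at a1 a2
    have b1 : z'.1 = z.1 := a1.resolve_right fun h =>
      hp _ hz'.1 (by rw [h]; exact hBp _ hz.2.1)
    have b2 : z'.2 = z.2 := a2.resolve_left fun h =>
      hp _ hz.1 (by rw [← h]; exact hBp _ hz'.2.1)
    exact (Sigma.ext b1 (heq_of_eq b2)).symm
  rw [← hT, ← Finset.card_image_of_injOn hinj, ← Set.ncard_coe_finset]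
  apply Set.ncard_le_ncard
  · intro q hq
    rw [Finset.mem_coe, Finset.mem_image] at hq
    obtain ⟨z, hz, rfl⟩ := hq
    have hm : mult A (X z.1 z.2) = 2 := by
      rw [mult_eq_card, hset z hz, Finset.card_pair]
      intro h
      simp only [T, Finset.mem_sigma, Finset.mem_sdiff] at hz
      exact hp _ hz.1 (by rw [h]; exact hBp _ hz.2.1)
    exact ⟨hm.ge, hm⟩
  · exact (finite_inter A).subset fun q hq => hq.1

end Cone

/-- A cone `A = C(A',p)_e` over a generic arrangement `A'` of
`d' ≥ 3` lines, with an arbitrary vertex `p`, satisfies `n₂ ≥ |A|/2`. -/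
theorem n2_ge_half_of_cone_generic (A' A : Finset ProjLine) (p : ProjPoint) (e : ℕ)
    (hd' : 3 ≤ A'.card) (hgen : IsGeneric A')
    (hcone : IsConeOf A' p e A) :
    (A.card : ℝ) / 2 ≤ (nk A 2 : ℝ) := by
  obtain ⟨hp, E, -, hE, hA⟩ := hcone
  let B := A.filter (PointOnLine p)
  have hBp : ∀ L ∈ B, PointOnLine p L := fun L hL => (Finset.mem_filter.1 hL).2
  have hAB : ∀ L, L ∈ A ↔ L ∈ A' ∨ L ∈ B := by
    intro L
    constructor
    · intro h
      rcases (hA L).1 h with h' | h' | h'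
      · exact Or.inl h'
      · exact Or.inr (Finset.mem_filter.2 ⟨h, (hE L h').1⟩)
      · exact Or.inr (Finset.mem_filter.2 ⟨h, h'.1⟩)
    · rintro (h | h)
      · exact (hA L).2 (Or.inl h)
      · exact (Finset.mem_filter.1 h).1
  have hB : ∀ L ∈ A', ∀ L' ∈ A', L ≠ L' → joinLine p L L' ∈ B := by
    intro L hL L' hL' hne
    obtain ⟨q, hq, hq'⟩ := exists_meet L L'
    have hj := joinLine_p hp hL hL' hne
    exact Finset.mem_filter.2 ⟨(hA _).2 (Or.inr (Or.inr ⟨hj, q,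
      two_le_mult.2 ⟨L, hL, L', hL', hne, hq, hq'⟩,
      (joinLine_on hp hL hL' hne hq).2 hq'⟩)), hj⟩
  have hcard : A.card = A'.card + B.card := by
    rw [← Finset.card_union_of_disjoint]
    · congr 1
      ext L
      rw [hAB, Finset.mem_union]
    · rw [Finset.disjoint_left]
      exact fun L h h' => hp L h (hBp L h')
  have h1 := pencil_card hd' hp hgen B hB
  have h2 := double_count hp hgen B hBp hAB hB
  obtain ⟨t, ht⟩ := Nat.exists_eq_add_of_le h1
  have h3 : B.card - (A'.card - 1) = t + 1 := by omega
  rw [h3] at h2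
  have h4 : A.card ≤ 2 * nk A 2 := by
    rw [hcard, ht]
    nlinarith
  have h5 : (A.card : ℝ) ≤ 2 * (nk A 2 : ℝ) := by exact_mod_cast h4
  linarith

end
end
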